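/- arXiv:2303.10063 — 2 statements merged into one kernel-verified Lean document; each statement's English description precedes it below -/
import Mathlib

section
/- (Lemma 3.3) Suppose α > 0, β > 0, n ∈ ℝ, κ ≥ 0, ε ∈ (0, ε₀], and let U^ε ∈ C³(Q) ∩ C²(Q̄) be a solution of the regularized unsteady problem. Set K₂ = (1/(8β²)) [ sup_{Y∈[0,R]} |Φ(|Ψ'(Y)|) Ψ''(Y)| + sup_{Y∈(0,R]} (1 + κ^α |Ψ'(Y)|^α)^{(n−1)/α} |Ψ'(Y)/Y| + b₀ ]. Then |∂U^ε/∂T (T,Y)| ≤ K₂ for all T ≥ 0 and Y ∈ [0,R]. -/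
open Set Filter Real intervalIntegral

/-- Partial derivative in time, taken within the time set `S`. -/
noncomputable def pT (S : Set ℝ) (U : ℝ → ℝ → ℝ) (T Y : ℝ) : ℝ :=
  derivWithin (fun t => U t Y) S T

/-- Partial derivative in the radial variable, taken within `[0,R]`. -/
noncomputable def pY (R : ℝ) (U : ℝ → ℝ → ℝ) (T Y : ℝ) : ℝ :=
  derivWithin (U T) (Icc 0 R) Y

/-- Second partial derivative in the radial variable, taken within `[0,R]`. -/
noncomputable def pYY (R : ℝ) (U : ℝ → ℝ → ℝ) (T Y : ℝ) : ℝ :=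
  derivWithin (fun y => pY R U T y) (Icc 0 R) Y

/-- The Carreau–Yasuda viscosity coefficient
`Φ(η) = (1 + n κ^α η^α)(1 + κ^α η^α)^{(n−1−α)/α}`. -/
noncomputable def Phi (α κ n : ℝ) (η : ℝ) : ℝ :=
  (1 + n * κ ^ α * η ^ α) * (1 + κ ^ α * η ^ α) ^ ((n - 1 - α) / α)

/-- `U` solves the regularized unsteady problem (non-divergence form):
`8β² U_T − Φ(|U_Y|) U_{YY} − (1/(Y+ε))(1+κ^α|U_Y|^α)^{(n−1)/α} U_Y = b(Y)` in `Q`,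
`U_Y(T,0) = U(T,R) = 0` for `T ≥ 0`, `U(0,Y) = Ψ(Y)` on `[0,R]`. -/
def RegUnsteadySol (α κ n β R ε : ℝ) (b Ψ : ℝ → ℝ) (U : ℝ → ℝ → ℝ) : Prop :=
  (∀ T > 0, ∀ Y ∈ Ioo 0 R,
    8 * β ^ 2 * pT (Ici 0) U T Y - Phi α κ n |pY R U T Y| * pYY R U T Y
      - (Y + ε)⁻¹ * (1 + κ ^ α * |pY R U T Y| ^ α) ^ ((n - 1) / α) * pY R U T Y = b Y) ∧
  (∀ T ≥ 0, pY R U T 0 = 0 ∧ U T R = 0) ∧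
  (∀ Y ∈ Icc 0 R, U 0 Y = Ψ Y)

/-- Compatibility conditions for the initial datum `Ψ`:
`Ψ'(0) = Ψ(R) = Ψ'(R) = 0` and `Ψ''(R) + b(R) = 0`. -/
def PsiCompat (R : ℝ) (b Ψ : ℝ → ℝ) : Prop :=
  derivWithin Ψ (Icc 0 R) 0 = 0 ∧ Ψ R = 0 ∧ derivWithin Ψ (Icc 0 R) R = 0 ∧
    derivWithin (derivWithin Ψ (Icc 0 R)) (Icc 0 R) R + b R = 0

/-- A classical solution of `u_T = Φ(u_Y) u_YY + F(u_Y) / (Y + ε) + b(Y)` on the strip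
`T > 0`, `0 ≤ Y ≤ R`, together with its derivatives, all extended continuously to the plane:
`p = u_Y`, `v = u_T`, `px = u_YY`, `pt = u_TY`, `vt = u_TT`. -/
structure StripSol (F Φ b : ℝ → ℝ) (R ε : ℝ) (u p v px pt vt : ℝ → ℝ → ℝ) : Prop where
  R_pos : 0 < R
  ε_pos : 0 < ε
  hF : ∀ x, HasDerivAt F (Φ x) x
  F_zero : F 0 = 0
  cΦ : Continuous Φ
  cb : Continuous b
  cu : Continuous fun x : ℝ × ℝ => u x.1 x.2
  cp : Continuous fun x : ℝ × ℝ => p x.1 x.2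
  cv : Continuous fun x : ℝ × ℝ => v x.1 x.2
  cpx : Continuous fun x : ℝ × ℝ => px x.1 x.2
  cpt : Continuous fun x : ℝ × ℝ => pt x.1 x.2
  cvt : Continuous fun x : ℝ × ℝ => vt x.1 x.2
  u_t : ∀ T > 0, ∀ Y ∈ Icc 0 R, HasDerivAt (fun t => u t Y) (v T Y) T
  p_t : ∀ T > 0, ∀ Y ∈ Icc 0 R, HasDerivAt (fun t => p t Y) (pt T Y) T
  v_t : ∀ T > 0, ∀ Y ∈ Icc 0 R, HasDerivAt (fun t => v t Y) (vt T Y) T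
  u_y : ∀ T > 0, ∀ Y ∈ Ioo 0 R, HasDerivAt (u T) (p T Y) Y
  p_y : ∀ T > 0, ∀ Y ∈ Ioo 0 R, HasDerivAt (p T) (px T Y) Y
  v_y : ∀ T > 0, ∀ Y ∈ Ioo 0 R, HasDerivAt (v T) (pt T Y) Y
  pde : ∀ T > 0, ∀ Y ∈ Icc 0 R,
    v T Y = Φ (p T Y) * px T Y + F (p T Y) / (Y + ε) + b Y
  p_zero : ∀ T ≥ 0, p T 0 = 0
  u_R : ∀ T ≥ 0, u T R = 0

/-- Differentiation under the integral sign for jointly continuous data. -/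
theorem hasDerivAt_integral_of_continuous_strip {f ft : ℝ → ℝ → ℝ} {a : ℝ} (ha : 0 ≤ a)
    (cf : Continuous fun x : ℝ × ℝ => f x.1 x.2) (cft : Continuous fun x : ℝ × ℝ => ft x.1 x.2)
    (h : ∀ T > 0, ∀ Y ∈ Icc 0 a, HasDerivAt (fun t => f t Y) (ft T Y) T) {T : ℝ} (hT : 0 < T) :
    HasDerivAt (fun t => ∫ y in (0:ℝ)..a, f t y) (∫ y in (0:ℝ)..a, ft T y) T := by
  obtain ⟨M, hM⟩ := (isCompact_Icc (a := T / 2) (b := T + 1)).prod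
    (isCompact_Icc (a := (0:ℝ)) (b := a)) |>.exists_bound_of_continuousOn cft.continuousOn
  have hs : Ioo (T / 2) (T + 1) ∈ nhds T := Ioo_mem_nhds (by linarith) (by linarith)
  refine (intervalIntegral.hasDerivAt_integral_of_dominated_loc_of_deriv_le
    (F := f) (F' := ft) (bound := fun _ => M) hs ?_ ?_ ?_ ?_ ?_ ?_).2
  · exact Eventually.of_forall fun t =>
      (cf.comp (by fun_prop : Continuous fun y : ℝ => (t, y))).aestronglyMeasurable
  · exact (cf.comp (by fun_prop : Continuous fun y : ℝ => (T, y))).intervalIntegrable _ _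
  · exact (cft.comp (by fun_prop : Continuous fun y : ℝ => (T, y))).aestronglyMeasurable
  · refine Eventually.of_forall fun y hy t ht => ?_
    rw [uIoc_of_le ha] at hy
    exact hM (t, y) ⟨⟨ht.1.le, ht.2.le⟩, ⟨hy.1.le, hy.2⟩⟩
  · exact intervalIntegrable_const
  · refine Eventually.of_forall fun y hy t ht => ?_
    rw [uIoc_of_le ha] at hy
    exact h t (by linarith [ht.1]) y ⟨hy.1.le, hy.2⟩

namespace StripSol

variable {F Φ b : ℝ → ℝ} {R ε : ℝ} {u p v px pt vt : ℝ → ℝ → ℝ}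

theorem continuous_F (S : StripSol F Φ b R ε u p v px pt vt) : Continuous F :=
  continuous_iff_continuousAt.2 fun x => (S.hF x).continuousAt

theorem continuous_p (S : StripSol F Φ b R ε u p v px pt vt) (T : ℝ) : Continuous (p T) :=
  S.cp.comp (by fun_prop : Continuous fun y : ℝ => (T, y))

theorem continuous_v (S : StripSol F Φ b R ε u p v px pt vt) (T : ℝ) : Continuous (v T) :=
  S.cv.comp (by fun_prop : Continuous fun y : ℝ => (T, y))

theorem continuous_u (S : StripSol F Φ b R ε u p v px pt vt) (T : ℝ) : Continuous (u T) :=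
  S.cu.comp (by fun_prop : Continuous fun y : ℝ => (T, y))

theorem continuous_vt (S : StripSol F Φ b R ε u p v px pt vt) (T : ℝ) : Continuous (vt T) :=
  S.cvt.comp (by fun_prop : Continuous fun y : ℝ => (T, y))

theorem continuous_pt (S : StripSol F Φ b R ε u p v px pt vt) (T : ℝ) : Continuous (pt T) :=
  S.cpt.comp (by fun_prop : Continuous fun y : ℝ => (T, y))

theorem continuous_px (S : StripSol F Φ b R ε u p v px pt vt) (T : ℝ) : Continuous (px T) :=
  S.cpx.comp (by fun_prop : Continuous fun y : ℝ => (T, y))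

theorem continuous_p_time (S : StripSol F Φ b R ε u p v px pt vt) (Y : ℝ) :
    Continuous fun t => p t Y :=
  S.cp.comp (by fun_prop : Continuous fun t : ℝ => (t, Y))

theorem continuous_v_time (S : StripSol F Φ b R ε u p v px pt vt) (Y : ℝ) :
    Continuous fun t => v t Y :=
  S.cv.comp (by fun_prop : Continuous fun t : ℝ => (t, Y))

theorem v_R (S : StripSol F Φ b R ε u p v px pt vt) {T : ℝ} (hT : 0 < T) : v T R = 0 := by
  have h1 := S.u_t T hT R ⟨S.R_pos.le, le_rfl⟩
  have h2 : HasDerivAt (fun t => u t R) 0 T :=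
    (hasDerivAt_const T (0:ℝ)).congr_of_eventuallyEq
      ((lt_mem_nhds hT).mono fun t ht => S.u_R t ht.le)
  exact h1.unique h2

/-- The flux `(Y + ε) F(p)` has `Y`-derivative `(Y + ε) (v - b)`. -/
theorem flux_y (S : StripSol F Φ b R ε u p v px pt vt) {T Y : ℝ} (hT : 0 < T)
    (hY : Y ∈ Ioo 0 R) :
    HasDerivAt (fun y => (y + ε) * F (p T y)) ((Y + ε) * (v T Y - b Y)) Y := by
  have h1 := ((hasDerivAt_id Y).add_const ε).mul ((S.hF (p T Y)).comp Y (S.p_y T hT Y hY))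
  refine h1.congr_deriv ?_
  have hr : Y + ε ≠ 0 := by linarith [hY.1, S.ε_pos]
  rw [S.pde T hT Y ⟨hY.1.le, hY.2.le⟩]
  simp only [id, Function.comp]
  field_simp
  ring

theorem flux_eq_integral (S : StripSol F Φ b R ε u p v px pt vt) {T Y : ℝ} (hT : 0 < T)
    (hY : Y ∈ Icc 0 R) :
    (Y + ε) * F (p T Y) = ∫ s in (0:ℝ)..Y, (s + ε) * (v T s - b s) := by
  have cF := S.continuous_F
  have c1 := S.continuous_p T
  have c2 := S.continuous_v T
  have c3 := S.cb
  rw [intervalIntegral.integral_eq_sub_of_hasDerivAt_of_le hY.1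
    (f := fun y => (y + ε) * F (p T y))]
  · simp [S.p_zero T hT.le, S.F_zero]
  · exact (by fun_prop : Continuous fun y => (y + ε) * F (p T y)).continuousOn
  · exact fun y hy => S.flux_y hT ⟨hy.1, hy.2.trans_le hY.2⟩
  · exact (by fun_prop : Continuous fun y => (y + ε) * (v T y - b y)).intervalIntegrable _ _

/-- Integrated form of the linear equation satisfied by `v = u_T`. -/
theorem flux_t_eq_integral (S : StripSol F Φ b R ε u p v px pt vt) {T Y : ℝ} (hT : 0 < T)
    (hY : Y ∈ Icc 0 R) :
    (Y + ε) * (Φ (p T Y) * pt T Y) = ∫ s in (0:ℝ)..Y, (s + ε) * vt T s := by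
  have cb := S.cb
  have cv := S.cv
  have cvt := S.cvt
  have h1 : HasDerivAt (fun t => ∫ s in (0:ℝ)..Y, (s + ε) * (v t s - b s))
      (∫ s in (0:ℝ)..Y, (s + ε) * vt T s) T := by
    refine hasDerivAt_integral_of_continuous_strip (f := fun t s => (s + ε) * (v t s - b s))
      (ft := fun t s => (s + ε) * vt t s) hY.1 (by fun_prop) (by fun_prop) ?_ hT
    intro t ht y hy
    exact ((S.v_t t ht y ⟨hy.1, hy.2.trans hY.2⟩).sub_const _).const_mul _
  have h2 : HasDerivAt (fun t => (Y + ε) * F (p t Y)) ((Y + ε) * (Φ (p T Y) * pt T Y)) T :=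
    ((S.hF (p T Y)).comp T (S.p_t T hT Y hY)).const_mul _
  refine h2.unique (h1.congr_of_eventuallyEq ?_)
  exact (lt_mem_nhds hT).mono fun t ht => S.flux_eq_integral ht hY

theorem flux_t_y (S : StripSol F Φ b R ε u p v px pt vt) {T : ℝ} (Y : ℝ) :
    HasDerivAt (fun y => ∫ s in (0:ℝ)..y, (s + ε) * vt T s) ((Y + ε) * vt T Y) Y := by
  have cvt := S.continuous_vt T
  have c : Continuous fun s => (s + ε) * vt T s := by fun_prop
  exact c.integral_hasStrictDerivAt 0 Y |>.hasDerivAt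

end StripSol

theorem eventually_gt_of_hasDerivAt_pos {f : ℝ → ℝ} {f' x : ℝ} (h : HasDerivAt f f' x)
    (hf : 0 < f') : ∀ᶠ y in nhdsWithin x (Ioi x), f x < f y := by
  have h1 := (hasDerivAt_iff_tendsto_slope.1 h).eventually (lt_mem_nhds hf)
  have h2 := h1.filter_mono (nhdsWithin_mono x fun y (hy : x < y) => hy.ne')
  filter_upwards [h2, self_mem_nhdsWithin] with y hy hxy
  have hxy' : 0 < y - x := sub_pos.2 hxy
  rw [slope_def_field, div_pos_iff_of_pos_right hxy'] at hy
  linarith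

theorem nonneg_of_hasDerivAt_of_eventually_le {f : ℝ → ℝ} {f' x : ℝ} (h : HasDerivAt f f' x)
    (hf : ∀ᶠ y in nhdsWithin x (Iio x), f y ≤ f x) : 0 ≤ f' := by
  have h1 := (hasDerivAt_iff_tendsto_slope.1 h).mono_left
    (nhdsWithin_mono x fun y (hy : y < x) => hy.ne : nhdsWithin x (Iio x) ≤ _)
  refine ge_of_tendsto h1 ?_
  filter_upwards [hf, self_mem_nhdsWithin] with y hy hxy
  rw [slope_def_field]
  exact div_nonneg_of_nonpos (by linarith) (sub_nonpos.2 (le_of_lt hxy))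

namespace StripSol

variable {F Φ b : ℝ → ℝ} {R ε : ℝ} {u p v px pt vt : ℝ → ℝ → ℝ}

theorem eventually_lt_v_of_pt_pos (S : StripSol F Φ b R ε u p v px pt vt) {T Y : ℝ} (hT : 0 < T)
    (hY : Y ∈ Ico 0 R) (hpt : ∀ᶠ y in nhdsWithin Y (Ioi Y), 0 < pt T y) :
    ∀ᶠ y in nhdsWithin Y (Ioi Y), y ∈ Icc 0 R ∧ v T Y < v T y := by
  have h1 : ∀ᶠ y in nhdsWithin Y (Ioi Y), 0 < pt T y ∧ y < R :=
    hpt.and (Filter.Eventually.filter_mono nhdsWithin_le_nhds (gt_mem_nhds hY.2))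
  obtain ⟨z, hz, hsub⟩ := mem_nhdsGT_iff_exists_Ioo_subset.1 h1
  have hz : Y < z := hz
  filter_upwards [Ioo_mem_nhdsGT hz] with y hy
  obtain ⟨-, hyR⟩ := hsub hy
  refine ⟨⟨hY.1.trans hy.1.le, hyR.le⟩, ?_⟩
  obtain ⟨c, hc, hc'⟩ := exists_hasDerivAt_eq_slope (v T) (pt T) hy.1
    (S.continuous_v T).continuousOn
    fun x hx => S.v_y T hT x ⟨hY.1.trans_lt hx.1, hx.2.trans hyR⟩
  have hpos : 0 < pt T c := (hsub ⟨hc.1, hc.2.trans hy.2⟩).1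
  rw [hc', div_pos_iff_of_pos_right (by linarith [hy.1])] at hpos
  linarith

/-- Where the equation is parabolic and `v` is increasing in time, `v` is not a spatial maximum. -/
theorem exists_lt_v_of_vt_pos (S : StripSol F Φ b R ε u p v px pt vt) {T Y : ℝ} (hT : 0 < T)
    (hY : Y ∈ Ico 0 R) (hΦ : 0 < Φ (p T Y)) (hvt : 0 < vt T Y) {W : Set ℝ}
    (hW : W ∈ nhds Y) : ∃ Y' ∈ W, Y' ∈ Icc 0 R ∧ v T Y < v T Y' := by
  have hε := S.ε_pos
  have hr : 0 < Y + ε := by linarith [hY.1]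
  set q : ℝ → ℝ := fun y => ∫ s in (0:ℝ)..y, (s + ε) * vt T s with hq
  have hqeq : ∀ y ∈ Icc 0 R, (y + ε) * (Φ (p T y) * pt T y) = q y := fun y hy =>
    S.flux_t_eq_integral hT hy
  rcases le_or_gt 0 (q Y) with h0 | h0
  · suffices h : ∀ᶠ y in nhdsWithin Y (Ioi Y), 0 < pt T y from
      ((Filter.Eventually.filter_mono nhdsWithin_le_nhds hW).and
        (S.eventually_lt_v_of_pt_pos hT hY h)).exists
    have hc : Continuous fun y => Φ (p T y) := S.cΦ.comp (S.continuous_p T)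
    filter_upwards [eventually_gt_of_hasDerivAt_pos (S.flux_t_y Y) (mul_pos hr hvt),
      mem_nhdsWithin_of_mem_nhds (hc.continuousAt.eventually (lt_mem_nhds hΦ)),
      mem_nhdsWithin_of_mem_nhds (gt_mem_nhds hY.2), self_mem_nhdsWithin] with y h1 h2 h3 h4
    have h4 : Y < y := h4
    have h5 := hqeq y ⟨by linarith [hY.1], le_of_lt h3⟩
    have h6 : 0 < (y + ε) * (Φ (p T y) * pt T y) := by rw [h5]; exact h0.trans_lt h1
    have h7 : 0 < y + ε := by linarith
    exact (pos_iff_pos_of_mul_pos ((pos_iff_pos_of_mul_pos h6).1 h7)).1 h2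
  · have hY0 : 0 < Y := by
      rcases hY.1.lt_or_eq with h | h
      · exact h
      · rw [← h] at h0; simp [hq] at h0
    have hpt : pt T Y < 0 := by
      have := hqeq Y ⟨hY.1, hY.2.le⟩
      by_contra hcon
      have : 0 ≤ (Y + ε) * (Φ (p T Y) * pt T Y) := by
        have := not_lt.1 hcon
        positivity
      linarith
    by_contra! hcon
    have hmax : IsLocalMax (v T) Y := by
      filter_upwards [hW, Icc_mem_nhds hY0 hY.2] with y h1 h2 using hcon y h1 h2
    exact hpt.ne (hmax.hasDerivAt_eq_zero (S.v_y T hT Y ⟨hY0, hY.2⟩))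

theorem le_vt_of_eventually_lt (S : StripSol F Φ b R ε u p v px pt vt) {T Y c δ : ℝ} (hT : 0 < T)
    (hY : Y ∈ Icc 0 R) (hv : c + δ * T ≤ v T Y)
    (h : ∀ᶠ t in nhdsWithin T (Iio T), v t Y < c + δ * t) : δ ≤ vt T Y := by
  have h1 : HasDerivAt (fun t => v t Y - (c + δ * t)) (vt T Y - δ * 1) T :=
    (S.v_t T hT Y hY).sub (((hasDerivAt_id T).const_mul δ).const_add c)
  have := nonneg_of_hasDerivAt_of_eventually_le h1 (h.mono fun t ht => by linarith)
  linarith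

/-- Maximum principle for `v` on the region `p ∈ C`, the equation being parabolic for `p ∈ O`. -/
theorem lt_of_barrier (S : StripSol F Φ b R ε u p v px pt vt) {O C : Set ℝ} (hO : IsOpen O)
    (hC : IsClosed C) (hOC : O ⊆ C) (hΦ : ∀ x ∈ O, 0 < Φ x) {c δ : ℝ} (hc : 0 < c) (hδ : 0 < δ)
    (h0 : ∀ Y ∈ Icc 0 R, v 0 Y < c)
    (contact : ∀ T > 0, ∀ Y ∈ Icc 0 R, p T Y ∈ C → p T Y ∉ O → c + δ * T ≤ v T Y →
      (∀ t, 0 ≤ t → t < T → ∀ y ∈ Icc 0 R, p t y ∈ C → v t y < c + δ * t) →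
      ∃ Y' ∈ Icc 0 R, p T Y' ∈ O ∧ c + δ * T < v T Y')
    {T Y : ℝ} (hT : 0 ≤ T) (hY : Y ∈ Icc 0 R) (hp : p T Y ∈ C) : v T Y < c + δ * T := by
  by_contra! hbad
  have cp := S.cp
  have cv := S.cv
  have hK : IsCompact ((Icc 0 T ×ˢ Icc 0 R) ∩
      ({x : ℝ × ℝ | p x.1 x.2 ∈ C} ∩ {x : ℝ × ℝ | c + δ * x.1 ≤ v x.1 x.2})) :=
    (isCompact_Icc.prod isCompact_Icc).inter_right
      ((hC.preimage cp).inter (isClosed_le (by fun_prop) cv))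
  obtain ⟨⟨t, y⟩, ⟨⟨ht, hy⟩, hpy, hvy⟩, hmin⟩ :=
    hK.exists_isMinOn ⟨(T, Y), ⟨⟨hT, le_rfl⟩, hY⟩, hp, hbad⟩ continuous_fst.continuousOn
  simp only [mem_ofPred_eq] at ht hy hpy hvy
  have hbefore : ∀ s, 0 ≤ s → s < t → ∀ z ∈ Icc 0 R, p s z ∈ C → v s z < c + δ * s := by
    intro s hs hst z hz hpz
    by_contra! hcon
    have h : t ≤ s := hmin (a := (s, z)) ⟨⟨⟨hs, hst.le.trans ht.2⟩, hz⟩, hpz, mem_ofPred.2 hcon⟩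
    linarith
  have ht0 : 0 < t := by
    rcases ht.1.lt_or_eq with h | h
    · exact h
    · have := h0 y hy
      rw [← h] at hvy
      linarith
  have hyR : y < R := by
    rcases hy.2.lt_or_eq with h | h
    · exact h
    · rw [h, S.v_R ht0] at hvy
      nlinarith
  have key : ∃ Y' ∈ Icc 0 R, p t Y' ∈ O ∧ c + δ * t < v t Y' := by
    by_cases hpO : p t y ∈ O
    · have hvt : δ ≤ vt t y := by
        refine S.le_vt_of_eventually_lt ht0 hy hvy ?_
        have h1 : ∀ᶠ s in nhds t, p s y ∈ O :=
          (S.continuous_p_time y).continuousAt.eventually (hO.mem_nhds hpO)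
        filter_upwards [mem_nhdsWithin_of_mem_nhds h1, self_mem_nhdsWithin,
          mem_nhdsWithin_of_mem_nhds (lt_mem_nhds ht0)] with s h2 h3 h4
        exact hbefore s (le_of_lt h4) h3 y hy (hOC h2)
      obtain ⟨Y', h1, h2, h3⟩ := S.exists_lt_v_of_vt_pos ht0 ⟨hy.1, hyR⟩ (hΦ _ hpO)
        (hδ.trans_le hvt) ((S.continuous_p t).continuousAt.preimage_mem_nhds (hO.mem_nhds hpO))
      exact ⟨Y', h2, h1, by linarith⟩
    · exact contact t ht0 y hy hpy hpO hvy hbefore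
  obtain ⟨Y', hY', hpO, hv⟩ := key
  have h1 : ∀ᶠ s in nhds t, p s Y' ∈ O :=
    (S.continuous_p_time Y').continuousAt.eventually (hO.mem_nhds hpO)
  have h2 : ∀ᶠ s in nhds t, c + δ * s < v s Y' :=
    (by fun_prop : Continuous fun s => c + δ * s).continuousAt.eventually_lt
      (S.continuous_v_time Y').continuousAt hv
  obtain ⟨s, ⟨h3, h4, h5⟩, h6⟩ := (((h1.and (h2.and (lt_mem_nhds ht0))).filter_mono
    (nhdsWithin_le_nhds (s := Iio t))).and self_mem_nhdsWithin).exists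
  have := hbefore s h5.le h6 Y' hY' (hOC h3)
  linarith

/-- Maximum principle for `v` when the equation is everywhere parabolic. -/
theorem le_of_forall_pos (S : StripSol F Φ b R ε u p v px pt vt) (hΦ : ∀ x, 0 < Φ x) {K : ℝ}
    (hK : 0 ≤ K) (h0 : ∀ Y ∈ Icc 0 R, v 0 Y ≤ K) {T Y : ℝ} (hT : 0 ≤ T) (hY : Y ∈ Icc 0 R) :
    v T Y ≤ K := by
  refine le_of_forall_pos_lt_add fun δ hδ => ?_
  have hd : 0 < δ / (1 + T) := by positivity
  have := S.lt_of_barrier (O := univ) (C := univ) isOpen_univ isClosed_univ subset_rfl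
    (fun x _ => hΦ x) (c := K + δ / (1 + T)) (by positivity) hd
    (fun y hy => (h0 y hy).trans_lt (by linarith)) (fun _ _ _ _ _ h => absurd (mem_univ _) h)
    hT hY (mem_univ _)
  calc v T Y < K + δ / (1 + T) + δ / (1 + T) * T := this
    _ = K + δ := by field_simp; ring

end StripSol

theorem hasDerivAt_mul_of_eq_zero {f g : ℝ → ℝ} {f' x : ℝ} (hf : HasDerivAt f f' x)
    (hfx : f x = 0) (hg : ContinuousAt g x) : HasDerivAt (fun y => f y * g y) (f' * g x) x := by
  rw [hasDerivAt_iff_tendsto_slope] at hf ⊢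
  refine (hf.mul (hg.tendsto.mono_left nhdsWithin_le_nhds)).congr fun y => ?_
  simp only [slope_def_field, hfx]
  ring

/-- A non-monotone flux law: `F` increases on `|x| < η` and decreases towards `0` on `η < |x|`. -/
structure FluxLaw (F Φ e : ℝ → ℝ) (η M : ℝ) : Prop where
  η_pos : 0 < η
  Φ_pos : ∀ x, |x| < η → 0 < Φ x
  Φ_neg : ∀ x, η < |x| → Φ x < 0
  Φ_eta : ∀ x, |x| = η → Φ x = 0
  Φ_le : ∀ x, |Φ x| ≤ M
  e_le : ∀ x, |e x| ≤ M
  hΦ : ∀ x ≠ 0, HasDerivAt Φ (e x / x) x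
  ce : Continuous e
  far : ∀ δ > 0, ∃ A, ∀ x, A ≤ |x| → 0 ≤ Φ x + e x ∧ |Φ x * x| ≤ δ
  F_odd : ∀ x, F (-x) = -F x
  Φ_even : ∀ x, Φ (-x) = Φ x
  F_nonneg : ∀ x, 0 ≤ x → 0 ≤ F x
  F_le : ∀ x, η ≤ |x| → |F x| ≤ F η

namespace StripSol

variable {F Φ e b : ℝ → ℝ} {R ε η M b₀ K : ℝ} {u p v px pt vt : ℝ → ℝ → ℝ}

/-- If the slope has reached the critical value initially, the initial bound controls the flux. -/
theorem flux_le_of_initial (S : StripSol F Φ b R ε u p v px pt vt) (L : FluxLaw F Φ e η M)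
    (hi : ∀ Y ∈ Ioc 0 R, b₀ + |F (p 0 Y)| / Y ≤ K) {Y : ℝ} (hY : Y ∈ Icc 0 R)
    (hp : η ≤ |p 0 Y|) : b₀ + F η / (Y + ε) ≤ K := by
  have hε := S.ε_pos
  have hη := L.η_pos
  obtain ⟨y, hy, hpy⟩ := intermediate_value_Icc hY.1
    (S.continuous_p 0).abs.continuousOn (show η ∈ Icc |p 0 0| |p 0 Y| by
      rw [S.p_zero 0 le_rfl, abs_zero]; exact ⟨L.η_pos.le, hp⟩)
  simp only at hpy
  have hy0 : 0 < y := by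
    rcases hy.1.lt_or_eq with h | h
    · exact h
    · rw [← h, S.p_zero 0 le_rfl, abs_zero] at hpy
      linarith
  have h1 := hi y ⟨hy0, hy.2.trans hY.2⟩
  have hF : |F (p 0 y)| = F η := by
    have h0 := abs_of_nonneg (L.F_nonneg η hη.le)
    rcases eq_or_eq_neg_of_abs_eq hpy with h | h
    · rw [h, h0]
    · rw [h, L.F_odd, abs_neg, h0]
  rw [hF] at h1
  have : F η / (Y + ε) ≤ F η / y :=
    div_le_div_of_nonneg_left (L.F_nonneg η hη.le) hy0 (by linarith [hy.2])
  linarith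

theorem v_eq_of_critical (S : StripSol F Φ b R ε u p v px pt vt) (L : FluxLaw F Φ e η M)
    {T Y : ℝ} (hT : 0 < T) (hY : Y ∈ Icc 0 R) (hp : p T Y = η) :
    v T Y = F η / (Y + ε) + b Y := by
  rw [S.pde T hT Y hY, hp, L.Φ_eta η (abs_of_pos L.η_pos)]
  ring

/-- Where the slope is at most critical, `v` is bounded by its initial bound. -/
theorem v_le_of_abs_p_le (S : StripSol F Φ b R ε u p v px pt vt) (L : FluxLaw F Φ e η M)
    (hb : ∀ Y ∈ Icc 0 R, |b Y| ≤ b₀) (hK : 0 ≤ K) (hbK : b₀ ≤ K) (h0 : ∀ Y ∈ Icc 0 R, v 0 Y ≤ K)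
    (hi : ∀ Y ∈ Ioc 0 R, b₀ + |F (p 0 Y)| / Y ≤ K) {T Y : ℝ} (hT : 0 ≤ T)
    (hY : Y ∈ Icc 0 R) (hp : |p T Y| ≤ η) : v T Y ≤ K := by
  have hε := S.ε_pos
  have hη := L.η_pos
  refine le_of_forall_pos_lt_add fun δ hδ => ?_
  have hd : 0 < δ / (1 + T) := by positivity
  suffices h : v T Y < K + δ / (1 + T) + δ / (1 + T) * T by
    calc v T Y < K + δ / (1 + T) + δ / (1 + T) * T := h
      _ = K + δ := by field_simp; ring
  generalize δ / (1 + T) = δ at hd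
  refine S.lt_of_barrier (O := Ioo (-η) η) (C := Icc (-η) η) isOpen_Ioo isClosed_Icc
    Ioo_subset_Icc_self (fun x hx => L.Φ_pos x (abs_lt.2 hx)) (c := K + δ) (by positivity) hd
    (fun y hy => (h0 y hy).trans_lt (by linarith)) ?_ hT hY (abs_le.1 hp)
  clear hp hY hT
  intro T hT Y hY hpC hpO hv hbefore
  have hr : 0 < Y + ε := by linarith [hY.1]
  have hbY := (abs_le.1 (hb Y hY)).2
  have hδT : 0 < δ * T := by positivity
  have hpη : p T Y = η := by
    by_contra hne
    have hpη : p T Y = -η := by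
      by_contra hne'
      exact hpO ⟨lt_of_le_of_ne hpC.1 (Ne.symm hne'), lt_of_le_of_ne hpC.2 hne⟩
    have := S.pde T hT Y hY
    rw [hpη, L.Φ_eta (-η) (by rw [abs_neg, abs_of_pos hη]), L.F_odd] at this
    have h2 : 0 ≤ F η / (Y + ε) := div_nonneg (L.F_nonneg η hη.le) hr.le
    rw [neg_div] at this
    linarith
  have hveq := S.v_eq_of_critical L hT hY hpη
  have hY0 : 0 < Y := by
    rcases hY.1.lt_or_eq with h | h
    · exact h
    · rw [← h, S.p_zero T hT.le] at hpη
      linarith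
  have hYR : Y < R := by
    rcases hY.2.lt_or_eq with h | h
    · exact h
    · rw [h, S.v_R hT] at hv
      linarith
  have hp0 : p 0 Y < η := by
    by_contra! hcon
    have := S.flux_le_of_initial L hi hY (hcon.trans (le_abs_self _))
    linarith
  have hlt : ∀ t, 0 ≤ t → t < T → p t Y < η := by
    intro t ht htT
    by_contra! hcon
    obtain ⟨s, hs, hps⟩ := intermediate_value_Icc ht (S.continuous_p_time Y).continuousOn
      ⟨hp0.le, hcon⟩
    simp only at hps
    have hs0 : 0 < s := by
      rcases hs.1.lt_or_eq with h | h
      · exact h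
      · rw [← h] at hps
        linarith
    have h1 := hbefore s hs.1 (hs.2.trans_lt htT) Y hY (by rw [hps]; exact ⟨by linarith, le_rfl⟩)
    rw [S.v_eq_of_critical L hs0 hY hps] at h1
    have := mul_lt_mul_of_pos_left (hs.2.trans_lt htT) hd
    linarith
  have hnear : ∀ᶠ t in nhdsWithin T (Iio T), 0 ≤ t ∧ t < T ∧ -η < p t Y := by
    have h1 : ∀ᶠ t in nhds T, -η < p t Y :=
      (S.continuous_p_time Y).continuousAt.eventually
        (lt_mem_nhds (show -η < p T Y by rw [hpη]; linarith))
    filter_upwards [h1.filter_mono nhdsWithin_le_nhds, self_mem_nhdsWithin,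
      mem_nhdsWithin_of_mem_nhds (lt_mem_nhds hT)] with t h2 h3 h4
    exact ⟨le_of_lt h4, h3, h2⟩
  have hvt : δ ≤ vt T Y := S.le_vt_of_eventually_lt hT hY hv <| hnear.mono fun t ht =>
    hbefore t ht.1 ht.2.1 Y hY ⟨ht.2.2.le, (hlt t ht.1 ht.2.1).le⟩
  have hpt0 : 0 ≤ pt T Y := nonneg_of_hasDerivAt_of_eventually_le (S.p_t T hT Y hY) <|
    hnear.mono fun t ht => by rw [hpη]; exact (hlt t ht.1 ht.2.1).le
  have hΦ0 : Φ (p T Y) = 0 := L.Φ_eta _ (by rw [hpη, abs_of_pos hη])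
  set q : ℝ → ℝ := fun y => ∫ s in (0:ℝ)..y, (s + ε) * vt T s with hq
  have hqeq : ∀ y ∈ Icc 0 R, (y + ε) * (Φ (p T y) * pt T y) = q y := fun y hy =>
    S.flux_t_eq_integral hT hy
  have hq' : HasDerivAt q ((Y + ε) * vt T Y) Y := S.flux_t_y Y
  have hqY : q Y = 0 := by rw [← hqeq Y hY, hΦ0]; ring
  have hpt : 0 < pt T Y := by
    refine hpt0.lt_of_ne fun h => ?_
    have h1 : HasDerivAt (fun y => Φ (p T y)) _ Y :=
      HasDerivAt.comp Y (L.hΦ (p T Y) (by rw [hpη]; exact hη.ne')) (S.p_y T hT Y ⟨hY0, hYR⟩)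
    have h2 := hasDerivAt_mul_of_eq_zero h1 hΦ0
      (g := fun y => (y + ε) * pt T y) (by have := S.continuous_pt T; fun_prop)
    have h3 : HasDerivAt q _ Y := h2.congr_of_eventuallyEq <| by
      filter_upwards [Icc_mem_nhds hY0 hYR] with y hy
      rw [← hqeq y hy]; ring
    have := hq'.unique h3
    rw [← h] at this
    nlinarith
  have hptr : ∀ᶠ y in nhdsWithin Y (Ioi Y), 0 < pt T y :=
    Filter.Eventually.filter_mono nhdsWithin_le_nhds
      ((S.continuous_pt T).continuousAt.eventually (lt_mem_nhds hpt))
  obtain ⟨y, ⟨⟨h1, h2⟩, h3⟩, h4⟩ :=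
    (((S.eventually_lt_v_of_pt_pos hT ⟨hY.1, hYR⟩ hptr).and hptr).and
    (eventually_gt_of_hasDerivAt_pos hq' (mul_pos hr (hd.trans_le hvt)))).exists
  refine ⟨y, h1, ?_, hv.trans_lt h2⟩
  rw [hqY, ← hqeq y h1] at h4
  have hry : 0 < y + ε := by linarith [h1.1]
  have hΦy : 0 < Φ (p T y) :=
    (pos_iff_pos_of_mul_pos ((pos_iff_pos_of_mul_pos h4).1 hry)).2 h3
  refine abs_lt.1 ?_
  by_contra! hcon
  rcases hcon.lt_or_eq with h | h
  · linarith [L.Φ_neg _ h]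
  · linarith [L.Φ_eta _ h.symm]

/-- The slope can only be supercritical where the flux is already under control. -/
theorem flux_le_of_le_abs_p (S : StripSol F Φ b R ε u p v px pt vt) (L : FluxLaw F Φ e η M)
    (hb : ∀ Y ∈ Icc 0 R, |b Y| ≤ b₀) (hK : 0 ≤ K) (hbK : b₀ ≤ K) (h0 : ∀ Y ∈ Icc 0 R, v 0 Y ≤ K)
    (hi : ∀ Y ∈ Ioc 0 R, b₀ + |F (p 0 Y)| / Y ≤ K) {T Y : ℝ} (hT : 0 ≤ T)
    (hY : Y ∈ Icc 0 R) (hp : η ≤ |p T Y|) : F (p T Y) / (Y + ε) + b Y ≤ K := by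
  have hη := L.η_pos
  have hr : 0 < Y + ε := by linarith [hY.1, S.ε_pos]
  have hbY := (abs_le.1 (hb Y hY)).2
  have hF : F (p T Y) ≤ F η := (le_abs_self _).trans (L.F_le _ hp)
  have hFr : F (p T Y) / (Y + ε) ≤ F η / (Y + ε) := by gcongr
  by_cases hinit : η ≤ |p 0 Y|
  · have := S.flux_le_of_initial L hi hY hinit
    linarith
  push Not at hinit
  rcases le_abs.1 hp with hp | hp
  · obtain ⟨s, hs, hps⟩ := intermediate_value_Icc hT (S.continuous_p_time Y).continuousOn
      ⟨(abs_lt.1 hinit).2.le, hp⟩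
    simp only at hps
    have hs0 : 0 < s := by
      rcases hs.1.lt_or_eq with h | h
      · exact h
      · rw [← h] at hps
        linarith [(abs_lt.1 hinit).2]
    have h1 := S.v_le_of_abs_p_le L hb hK hbK h0 hi hs.1 hY (by rw [hps, abs_of_pos hη])
    rw [S.v_eq_of_critical L hs0 hY hps] at h1
    linarith
  · have h1 : F (p T Y) ≤ 0 := by
      have h2 := L.F_nonneg (-p T Y) (by linarith)
      rw [L.F_odd] at h2
      linarith
    have := div_nonpos_of_nonpos_of_nonneg h1 hr.le
    linarith

theorem neg (S : StripSol F Φ b R ε u p v px pt vt) (hF : ∀ x, F (-x) = -F x)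
    (hΦ : ∀ x, Φ (-x) = Φ x) :
    StripSol F Φ (fun y => -b y) R ε (fun t y => -u t y) (fun t y => -p t y) (fun t y => -v t y)
      (fun t y => -px t y) (fun t y => -pt t y) (fun t y => -vt t y) where
  R_pos := S.R_pos
  ε_pos := S.ε_pos
  hF := S.hF
  F_zero := S.F_zero
  cΦ := S.cΦ
  cb := S.cb.neg
  cu := S.cu.neg
  cp := S.cp.neg
  cv := S.cv.neg
  cpx := S.cpx.neg
  cpt := S.cpt.neg
  cvt := S.cvt.neg
  u_t T hT Y hY := (S.u_t T hT Y hY).neg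
  p_t T hT Y hY := (S.p_t T hT Y hY).neg
  v_t T hT Y hY := (S.v_t T hT Y hY).neg
  u_y T hT Y hY := (S.u_y T hT Y hY).neg
  p_y T hT Y hY := (S.p_y T hT Y hY).neg
  v_y T hT Y hY := (S.v_y T hT Y hY).neg
  pde T hT Y hY := by
    rw [hF, hΦ, S.pde T hT Y hY]
    ring
  p_zero T hT := by rw [S.p_zero T hT, neg_zero]
  u_R T hT := by rw [S.u_R T hT, neg_zero]

/-- If `u_T ≤ K` at critical points of `u`, then `u` grows at most at rate `K`. -/
theorem u_le (S : StripSol F Φ b R ε u p v px pt vt) (hK : 0 ≤ K)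
    (hv : ∀ T > 0, ∀ Y ∈ Icc 0 R, p T Y = 0 → v T Y ≤ K) :
    ∃ C, 0 ≤ C ∧ ∀ T ≥ 0, ∀ Y ∈ Icc 0 R, u T Y ≤ C + K * T := by
  have cu := S.cu
  have hR := S.R_pos
  obtain ⟨C, hC⟩ := (isCompact_Icc (a := (0:ℝ)) (b := R)).exists_bound_of_continuousOn
    (S.continuous_u 0).continuousOn
  have hC0 : 0 ≤ C := (norm_nonneg _).trans (hC 0 ⟨le_rfl, hR.le⟩)
  refine ⟨C, hC0, fun T hT Y hY => ?_⟩
  refine le_of_forall_pos_lt_add fun δ hδ => ?_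
  have hd : 0 < δ / (1 + T) := by positivity
  suffices h : u T Y < C + δ / (1 + T) + (K + δ / (1 + T)) * T by
    calc u T Y < C + δ / (1 + T) + (K + δ / (1 + T)) * T := h
      _ = C + K * T + δ := by field_simp; ring
  generalize δ / (1 + T) = δ at hd
  by_contra! hbad
  have hcomp : IsCompact ((Icc 0 T ×ˢ Icc 0 R) ∩
      {x : ℝ × ℝ | C + δ + (K + δ) * x.1 ≤ u x.1 x.2}) :=
    (isCompact_Icc.prod isCompact_Icc).inter_right (isClosed_le (by fun_prop) cu)
  obtain ⟨⟨t, y⟩, ⟨⟨ht, hy⟩, huy⟩, hmin⟩ :=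
    hcomp.exists_isMinOn ⟨(T, Y), ⟨⟨hT, le_rfl⟩, hY⟩, hbad⟩ continuous_fst.continuousOn
  simp only [mem_ofPred_eq] at ht hy huy
  have hbefore : ∀ s, 0 ≤ s → s < t → ∀ z ∈ Icc 0 R, u s z < C + δ + (K + δ) * s := by
    intro s hs hst z hz
    by_contra! hcon
    have h : t ≤ s := hmin (a := (s, z)) ⟨⟨⟨hs, hst.le.trans ht.2⟩, hz⟩, mem_ofPred.2 hcon⟩
    linarith
  have ht0 : 0 < t := by
    rcases ht.1.lt_or_eq with h | h
    · exact h
    · have := (le_abs_self _).trans (hC y hy)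
      rw [← h] at huy
      linarith
  have hat : ∀ z ∈ Icc 0 R, u t z ≤ C + δ + (K + δ) * t := by
    intro z hz
    by_contra! hcon
    have h1 : ∀ᶠ s in nhds t, C + δ + (K + δ) * s < u s z :=
      (by fun_prop : Continuous fun s => C + δ + (K + δ) * s).continuousAt.eventually_lt
        (by fun_prop : Continuous fun s => u s z).continuousAt hcon
    obtain ⟨s, ⟨h2, h3⟩, h4⟩ := (((h1.and (lt_mem_nhds ht0)).filter_mono
      (nhdsWithin_le_nhds (s := Iio t))).and self_mem_nhdsWithin).exists
    linarith [hbefore s h3.le h4 z hz]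
  have hyR : y < R := by
    rcases hy.2.lt_or_eq with h | h
    · exact h
    · rw [h, S.u_R t ht0.le] at huy
      have : 0 ≤ (K + δ) * t := by positivity
      linarith
  have hp : p t y = 0 := by
    rcases hy.1.lt_or_eq with h | h
    · refine IsLocalMax.hasDerivAt_eq_zero ?_ (S.u_y t ht0 y ⟨h, hyR⟩)
      filter_upwards [Icc_mem_nhds h hyR] with z hz
      exact (hat z hz).trans huy
    · rw [← h, S.p_zero t ht0.le]
  have h1 : HasDerivAt (fun s => u s y - (C + δ + (K + δ) * s)) (v t y - (K + δ) * 1) t :=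
    (S.u_t t ht0 y hy).sub (((hasDerivAt_id t).const_mul (K + δ)).const_add (C + δ))
  have h2 := nonneg_of_hasDerivAt_of_eventually_le h1 (by
    filter_upwards [self_mem_nhdsWithin, mem_nhdsWithin_of_mem_nhds (lt_mem_nhds ht0)]
      with s h3 h4
    linarith [hbefore s (le_of_lt h4) h3 y hy])
  linarith [hv t ht0 y hy hp]

end StripSol

namespace FluxLaw

variable {F Φ e : ℝ → ℝ} {η M : ℝ}

/-- A Gaussian `A exp (-k x²)` is a barrier for the linearized equation in the backward region. -/
theorem exists_barrier (L : FluxLaw F Φ e η M) {γ ε B : ℝ} (hγ : 0 < γ) (hε : 0 < ε)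
    (hB : 0 ≤ B) : ∃ A k : ℝ, 0 ≤ A ∧ 0 ≤ k ∧ ∀ x y w D r, η < |x| → γ ≤ -(Φ x * y) → γ / 2 ≤ w →
      |D| ≤ B → ε ≤ r → 0 ≤ w + Φ x * y - Φ x * x / r + e x * y
        - A * exp (-(k * x ^ 2)) * (4 * k ^ 2 * x ^ 2 - 2 * k) * y * (Φ x * y)
        + A * exp (-(k * x ^ 2)) * (-(2 * k * x)) * D := by
  have hη := L.η_pos
  have hM : 0 < M := by
    have h1 := L.Φ_neg (η + 1) (by rw [abs_of_pos (by linarith)]; linarith)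
    linarith [L.Φ_le (η + 1), neg_abs_le (Φ (η + 1))]
  obtain ⟨A₁, hA₁⟩ := L.far (ε * γ / 2) (by positivity)
  wlog hA₁0 : 0 ≤ A₁ generalizing A₁
  · exact this 0 (fun x hx => hA₁ x (by linarith)) le_rfl
  set k : ℝ := 1 / η ^ 2 + 2 * B * M / (η * γ ^ 2) with hk
  have hk0 : 0 < k := by positivity
  have hk1 : 1 ≤ k * η ^ 2 := by
    have : k * η ^ 2 = 1 + 2 * B * M * η / γ ^ 2 := by rw [hk]; field_simp
    rw [this]
    have : 0 ≤ 2 * B * M * η / γ ^ 2 := by positivity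
    linarith
  have hk2 : 2 * B * M ≤ k * η * γ ^ 2 := by
    have : k * η * γ ^ 2 = 2 * B * M + γ ^ 2 / η := by rw [hk]; field_simp; ring
    rw [this]
    have : 0 ≤ γ ^ 2 / η := by positivity
    linarith
  set Z : ℝ := 2 * M + M ^ 2 * A₁ / (ε * γ) with hZ
  refine ⟨Z * exp (k * A₁ ^ 2) / (k ^ 2 * η ^ 2 * γ), k, by positivity, hk0.le, ?_⟩
  set A : ℝ := Z * exp (k * A₁ ^ 2) / (k ^ 2 * η ^ 2 * γ) with hA
  have hA0 : 0 ≤ A := by positivity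
  intro x y w D r hx hX hw hD hr
  have hr0 : 0 < r := hε.trans_le hr
  have hΦn := L.Φ_neg x hx
  have hΦM := abs_le.1 (L.Φ_le x)
  have heM := abs_le.1 (L.e_le x)
  have hy : 0 < y := by
    by_contra! hcon
    have := mul_nonneg_of_nonpos_of_nonpos hΦn.le hcon
    linarith
  have hXM : -(Φ x * y) ≤ M * y := by
    rw [← neg_mul]
    exact mul_le_mul_of_nonneg_right (by linarith) hy.le
  have hyM : γ ≤ M * y := hX.trans hXM
  set X := -(Φ x * y) with hXdef
  set E := exp (-(k * x ^ 2)) with hE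
  have hE0 : 0 < E := exp_pos _
  have hx2 : η ^ 2 ≤ x ^ 2 := by rw [← sq_abs x]; gcongr
  have hkx : 1 ≤ k * x ^ 2 := hk1.trans (by gcongr)
  set P := 2 * k ^ 2 * x ^ 2 * (A * E) with hP
  have hP0 : 0 ≤ P := by positivity
  have hg2 : P ≤ A * E * (4 * k ^ 2 * x ^ 2 - 2 * k) := by
    have : 0 ≤ A * E * (2 * k) * (k * x ^ 2 - 1) :=
      mul_nonneg (by positivity) (by linarith)
    rw [hP]; linarith
  have hyX : 0 ≤ y * X := mul_nonneg hy.le (hγ.le.trans hX)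
  have hmain : P * (y * X) ≤ A * E * (4 * k ^ 2 * x ^ 2 - 2 * k) * (y * X) := by gcongr
  -- the drift term takes half of the convexity of the barrier
  have hdrift : |A * E * (-(2 * k * x)) * D| ≤ P * (y * X) / 2 := by
    have h1 : |A * E * (-(2 * k * x)) * D| ≤ A * E * (2 * k * |x|) * B := by
      rw [abs_mul, abs_mul, abs_of_nonneg (by positivity : 0 ≤ A * E), abs_neg, abs_mul,
        abs_of_nonneg (by positivity : 0 ≤ 2 * k)]
      gcongr
    have h2 : 2 * B ≤ k * |x| * (y * X) := by
      have h3 : γ ^ 2 ≤ M * (y * X) := by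
        calc γ ^ 2 = γ * γ := by ring
          _ ≤ M * y * X := by gcongr
          _ = _ := by ring
      have h4 : 2 * B * M ≤ k * |x| * (y * X) * M := by
        calc 2 * B * M ≤ k * η * γ ^ 2 := hk2
          _ ≤ k * |x| * (M * (y * X)) := by gcongr
          _ = _ := by ring
      exact le_of_mul_le_mul_right h4 hM
    have h5 : A * E * (2 * k * |x|) * (2 * B) ≤ A * E * (2 * k * |x|) * (k * |x| * (y * X)) := by
      gcongr
    have h6 : A * E * (2 * k * |x|) * (k * |x| * (y * X)) = P * (y * X) := by
      rw [hP, ← sq_abs x]; ring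
    linarith
  have hdr := (abs_le.1 hdrift).1
  suffices h : 0 ≤ w - X - Φ x * x / r + e x * y + P * (y * X) / 2 by
    have h1 : A * E * (4 * k ^ 2 * x ^ 2 - 2 * k) * y * (Φ x * y)
      = -(A * E * (4 * k ^ 2 * x ^ 2 - 2 * k) * (y * X)) := by rw [hXdef]; ring
    rw [h1]
    have h2 : Φ x * y = -X := by rw [hXdef]; ring
    rw [h2]
    linarith
  have hq : Φ x * x / r ≤ |Φ x * x| / ε := by
    calc Φ x * x / r ≤ |Φ x * x| / r := by gcongr; exact le_abs_self _
      _ ≤ |Φ x * x| / ε := by gcongr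
  rcases le_or_gt A₁ |x| with hfar | hnear
  · obtain ⟨h1, h2⟩ := hA₁ x hfar
    have h3 : |Φ x * x| / ε ≤ γ / 2 := by
      rw [div_le_iff₀ hε]; linarith
    have h4 : 0 ≤ (Φ x + e x) * y := by positivity
    have h5 : 0 ≤ P * (y * X) / 2 := by positivity
    have h6 : -X + e x * y = (Φ x + e x) * y := by rw [hXdef]; ring
    linarith
  · have h1 : |Φ x * x| / ε ≤ M ^ 2 * A₁ / (ε * γ) * y := by
      rw [abs_mul]
      calc |Φ x| * |x| / ε ≤ M * A₁ / ε := by gcongr; exact L.Φ_le x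
        _ = M * A₁ / (ε * γ) * γ := by field_simp
        _ ≤ M * A₁ / (ε * γ) * (M * y) := by gcongr
        _ = _ := by ring
    have h2 : X ≤ M * y := hXM
    have h3 : -(M * y) ≤ e x * y := by
      rw [← neg_mul]
      exact mul_le_mul_of_nonneg_right heM.1 hy.le
    have h4 : Z * y ≤ P * (y * X) / 2 := by
      have h5 : exp (-(k * A₁ ^ 2)) ≤ E := by
        refine exp_le_exp.2 (neg_le_neg ?_)
        rw [← sq_abs x]
        gcongr
      have h6 : 2 * Z / γ ≤ P := by
        calc 2 * Z / γ = 2 * k ^ 2 * η ^ 2 * (A * exp (-(k * A₁ ^ 2))) := by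
              rw [hA, exp_neg]; field_simp
          _ ≤ P := by rw [hP]; gcongr
      calc Z * y = 2 * Z / γ * (y * γ) / 2 := by field_simp
        _ ≤ P * (y * X) / 2 := by gcongr
    have h7 : Z * y = 2 * (M * y) + M ^ 2 * A₁ / (ε * γ) * y := by rw [hZ]; ring
    linarith

end FluxLaw

namespace StripSol

variable {F Φ b : ℝ → ℝ} {R ε : ℝ} {u p v px pt vt : ℝ → ℝ → ℝ}

/-- Dissipation of the energy `∫ (W(u_Y) - b u) (Y + ε)`, where `W' = F`. -/
theorem hasDerivAt_energy (S : StripSol F Φ b R ε u p v px pt vt) {T : ℝ} (hT : 0 < T) :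
    HasDerivAt (fun t => ∫ y in (0:ℝ)..R, (y + ε) * ((∫ s in (0:ℝ)..p t y, F s) - b y * u t y))
      (-∫ y in (0:ℝ)..R, (y + ε) * v T y ^ 2) T := by
  have cF := S.continuous_F
  have cΦ := S.cΦ
  have cb := S.cb
  have cu := S.cu
  have cp := S.cp
  have cv := S.cv
  have cpt := S.cpt
  have cpT := S.continuous_p T
  have cvT := S.continuous_v T
  have cptT := S.continuous_pt T
  have hW : ∀ x, HasDerivAt (fun x => ∫ s in (0:ℝ)..x, F s) (F x) x := fun x =>
    (cF.integral_hasStrictDerivAt 0 x).hasDerivAt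
  have cW : Continuous fun x => ∫ s in (0:ℝ)..x, F s :=
    continuous_iff_continuousAt.2 fun x => (hW x).continuousAt
  have h1 : HasDerivAt
      (fun t => ∫ y in (0:ℝ)..R, (y + ε) * ((∫ s in (0:ℝ)..p t y, F s) - b y * u t y))
      (∫ y in (0:ℝ)..R, (y + ε) * (F (p T y) * pt T y - b y * v T y)) T := by
    refine hasDerivAt_integral_of_continuous_strip
      (f := fun t y => (y + ε) * ((∫ s in (0:ℝ)..p t y, F s) - b y * u t y))
      (ft := fun t y => (y + ε) * (F (p t y) * pt t y - b y * v t y)) S.R_pos.le ?_ ?_ ?_ hT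
    · have : Continuous fun x : ℝ × ℝ => ∫ s in (0:ℝ)..p x.1 x.2, F s := cW.comp cp
      fun_prop
    · fun_prop
    · intro t ht y hy
      exact (((hW (p t y)).comp t (S.p_t t ht y hy)).sub
        ((S.u_t t ht y hy).const_mul (b y))).const_mul (y + ε)
  have h2 : ∫ y in (0:ℝ)..R, ((y + ε) * (v T y - b y) * v T y +
      (y + ε) * F (p T y) * pt T y) = 0 := by
    rw [intervalIntegral.integral_eq_sub_of_hasDerivAt_of_le S.R_pos.le
      (f := fun y => (y + ε) * F (p T y) * v T y)]
    · simp [S.p_zero T hT.le, S.F_zero, S.v_R hT]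
    · exact (by fun_prop : Continuous fun y => (y + ε) * F (p T y) * v T y).continuousOn
    · exact fun y hy => (S.flux_y hT hy).mul (S.v_y T hT y hy)
    · exact (by fun_prop : Continuous fun y => (y + ε) * (v T y - b y) * v T y +
        (y + ε) * F (p T y) * pt T y).intervalIntegrable _ _
  refine h1.congr_deriv ?_
  refine (sub_zero _).symm.trans ((congrArg _ h2.symm).trans ?_)
  rw [← intervalIntegral.integral_sub, ← intervalIntegral.integral_neg]
  · congr 1
    ext y
    ring
  · exact (by fun_prop : Continuous fun y =>
      (y + ε) * (F (p T y) * pt T y - b y * v T y)).intervalIntegrable _ _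
  · exact (by fun_prop : Continuous fun y => (y + ε) * (v T y - b y) * v T y +
      (y + ε) * F (p T y) * pt T y).intervalIntegrable _ _

/-- If `u` grows at most linearly, the dissipation cannot grow linearly. -/
theorem dissipation_not_growing (S : StripSol F Φ b R ε u p v px pt vt)
    (hodd : ∀ x, F (-x) = -F x) (hnn : ∀ x, 0 ≤ x → 0 ≤ F x) {C a T₀ : ℝ}
    (hC : ∀ T ≥ 0, ∀ Y ∈ Icc 0 R, |u T Y| ≤ C * (1 + T)) (hT₀ : 0 < T₀) (ha : 0 < a)
    (h : ∀ T ≥ T₀, a * (1 + T) ≤ ∫ y in (0:ℝ)..R, (y + ε) * v T y ^ 2) : False := by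
  have hR := S.R_pos
  have hε := S.ε_pos
  have cF := S.continuous_F
  have cb := S.cb
  have cu := S.cu
  have cp := S.cp
  set J : ℝ → ℝ := fun t =>
    ∫ y in (0:ℝ)..R, (y + ε) * ((∫ s in (0:ℝ)..p t y, F s) - b y * u t y) with hJ
  have hC0 : 0 ≤ C := by
    have := (abs_nonneg _).trans (hC 0 le_rfl 0 ⟨le_rfl, hR.le⟩)
    linarith
  obtain ⟨B, hB⟩ := (isCompact_Icc (a := (0:ℝ)) (b := R)).exists_bound_of_continuousOn
    cb.continuousOn
  have hB0 : 0 ≤ B := (norm_nonneg _).trans (hB 0 ⟨le_rfl, hR.le⟩)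
  have hW : ∀ x, 0 ≤ ∫ s in (0:ℝ)..x, F s := by
    intro x
    rcases le_total 0 x with hx | hx
    · exact intervalIntegral.integral_nonneg hx fun s hs => hnn s hs.1
    · rw [intervalIntegral.integral_symm, ← intervalIntegral.integral_neg]
      refine intervalIntegral.integral_nonneg hx fun s hs => ?_
      rw [← hodd]
      exact hnn _ (by linarith [hs.2])
  have cW : Continuous fun x => ∫ s in (0:ℝ)..x, F s :=
    continuous_iff_continuousAt.2 fun x =>
      (cF.integral_hasStrictDerivAt 0 x).hasDerivAt.continuousAt
  have hlow : ∀ T ≥ 0, -((R + ε) * (B * C) * R * (1 + T)) ≤ J T := by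
    intro T hT
    have h1 : ∫ y in (0:ℝ)..R, -((R + ε) * (B * C) * (1 + T)) ≤ J T := by
      refine intervalIntegral.integral_mono_on hR.le intervalIntegrable_const ?_ ?_
      · have cpT := S.continuous_p T
        have : Continuous fun y => ∫ s in (0:ℝ)..p T y, F s := cW.comp cpT
        exact (by fun_prop : Continuous fun y =>
          (y + ε) * ((∫ s in (0:ℝ)..p T y, F s) - b y * u T y)).intervalIntegrable _ _
      · intro y hy
        have h2 : |b y * u T y| ≤ B * (C * (1 + T)) := by
          rw [abs_mul]
          exact mul_le_mul (hB y hy) (hC T hT y hy) (abs_nonneg _) hB0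
        have h3 := (abs_le.1 h2).2
        have h4 : -(B * (C * (1 + T))) ≤ (∫ s in (0:ℝ)..p T y, F s) - b y * u T y := by
          linarith [hW (p T y)]
        have h5 : (y + ε) * (B * (C * (1 + T))) ≤ (R + ε) * (B * (C * (1 + T))) := by
          have : 0 ≤ B * (C * (1 + T)) := by positivity
          have := hy.2
          gcongr
        have h6 := mul_le_mul_of_nonneg_left h4 (by linarith [hy.1] : 0 ≤ y + ε)
        linarith
    rw [intervalIntegral.integral_const, smul_eq_mul] at h1
    linarith
  set G : ℝ → ℝ := fun t => J t + a * (t + t ^ 2 / 2) with hG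
  have hGd : ∀ T > 0, HasDerivAt G
      ((-∫ y in (0:ℝ)..R, (y + ε) * v T y ^ 2) + a * (1 + 2 * T ^ 1 * 1 / 2)) T := by
    intro T hT
    refine (S.hasDerivAt_energy hT).add (HasDerivAt.const_mul a ?_)
    exact (hasDerivAt_id T).add (((hasDerivAt_id T).pow 2).div_const 2)
  have hanti : AntitoneOn G (Ici T₀) := by
    refine antitoneOn_of_hasDerivWithinAt_nonpos (convex_Ici T₀)
      (fun t ht => (hGd t (hT₀.trans_le ht)).continuousAt.continuousWithinAt)
      (fun t ht => (hGd t ?_).hasDerivWithinAt) fun t ht => ?_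
    · rw [interior_Ici] at ht
      exact hT₀.trans ht
    · rw [interior_Ici] at ht
      have := h t (le_of_lt ht)
      linarith
  set C' := (R + ε) * (B * C) * R with hC'
  have hC'0 : 0 ≤ C' := by positivity
  set T := T₀ + 1 + 2 * (|G T₀| + 2 * C') / a with hTdef
  have hq : 0 ≤ 2 * (|G T₀| + 2 * C') / a := by positivity
  have hT1 : 1 ≤ T := by linarith
  have h1 : G T ≤ G T₀ := hanti self_mem_Ici (by show T₀ ≤ T; linarith) (by linarith)
  have h2 := hlow T (by linarith)
  have h3 : a * T > 2 * (|G T₀| + 2 * C') := by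
    have : a * T = a * (T₀ + 1) + 2 * (|G T₀| + 2 * C') := by rw [hTdef]; field_simp
    rw [this]
    have : 0 < a * (T₀ + 1) := by positivity
    linarith
  have h4 : G T = J T + a * (T + T ^ 2 / 2) := rfl
  have h5 : |G T₀| + 2 * C' ≤ (|G T₀| + 2 * C') * T := le_mul_of_one_le_right (by positivity) hT1
  have h6 : C' ≤ C' * T := le_mul_of_one_le_right hC'0 hT1
  have h7 : 2 * (|G T₀| + 2 * C') * T ≤ a * T * T := by gcongr
  have h8 : |G T₀| ≤ |G T₀| * T := le_mul_of_one_le_right (by positivity) hT1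
  have h9 := le_abs_self (G T₀)
  have h10 : 0 < a * T := by positivity
  linarith

end StripSol

theorem hasDerivAt_sq_max_zero (z : ℝ) :
    HasDerivAt (fun x : ℝ => max x 0 ^ 2) (2 * max z 0) z := by
  rcases lt_trichotomy z 0 with h | h | h
  · rw [max_eq_right h.le, mul_zero]
    refine (hasDerivAt_const z (0:ℝ)).congr_of_eventuallyEq ?_
    filter_upwards [gt_mem_nhds h] with x hx
    rw [max_eq_right (le_of_lt hx)]
    norm_num
  · subst h
    have h1 := hasDerivAt_mul_of_eq_zero (hasDerivAt_id (0:ℝ)) rfl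
      (g := fun x => max x 0) (by fun_prop)
    refine (h1.congr_of_eventuallyEq (Eventually.of_forall fun x => ?_)).congr_deriv (by simp)
    rcases le_total x 0 with hx | hx
    · simp [max_eq_right hx]
    · simp [max_eq_left hx, sq]
  · rw [max_eq_left h.le]
    refine ((hasDerivAt_pow 2 z).congr_of_eventuallyEq ?_).congr_deriv (by simp)
    filter_upwards [lt_mem_nhds h] with x hx
    rw [max_eq_left (le_of_lt hx)]

/-- A convex `C²` function vanishing exactly on `z ≤ 0`, of linear growth. -/
theorem exists_convex_cutoff : ∃ j φ φ' : ℝ → ℝ, (∀ z, HasDerivAt j (φ z) z) ∧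
    (∀ z, HasDerivAt φ (φ' z) z) ∧ Continuous φ' ∧ (∀ z ≤ 0, j z = 0 ∧ φ z = 0 ∧ φ' z = 0) ∧
    ∀ z > 0, 0 < j z ∧ j z ≤ z ∧ 0 ≤ φ z ∧ 0 ≤ φ' z := by
  set φ : ℝ → ℝ := fun z => max z 0 ^ 2 / (1 + max z 0 ^ 2) with hφ
  set φ' : ℝ → ℝ := fun z => 2 * max z 0 / (1 + max z 0 ^ 2) ^ 2 with hφ'
  have hne : ∀ z : ℝ, 1 + max z 0 ^ 2 ≠ 0 := fun z => by positivity
  have hd : ∀ z, HasDerivAt φ (φ' z) z := by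
    intro z
    refine ((hasDerivAt_sq_max_zero z).div ((hasDerivAt_sq_max_zero z).const_add 1)
      (hne z)).congr_deriv ?_
    simp only [hφ']
    congr 1
    ring
  have cφ : Continuous φ := continuous_iff_continuousAt.2 fun x => (hd x).continuousAt
  have h0 : ∀ z ≤ 0, φ z = 0 ∧ φ' z = 0 := by
    intro z hz
    simp [hφ, hφ', max_eq_right hz]
  have hφ0 : ∀ z, 0 ≤ φ z := fun z => by simp only [hφ]; positivity
  have hφ1 : ∀ z, φ z ≤ 1 := fun z => by
    simp only [hφ]
    rw [div_le_one (by positivity)]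
    linarith
  refine ⟨fun z => ∫ s in (0:ℝ)..z, φ s, φ, φ', fun z =>
    (cφ.integral_hasStrictDerivAt 0 z).hasDerivAt, hd, ?_, fun z hz => ⟨?_, h0 z hz⟩,
    fun z hz => ⟨?_, ?_, hφ0 z, ?_⟩⟩
  · exact Continuous.div (by fun_prop) (by fun_prop) fun z => pow_ne_zero 2 (hne z)
  · simp only
    rw [intervalIntegral.integral_congr (g := fun _ => (0:ℝ))]
    · simp
    · intro s hs
      rw [uIcc_of_ge hz] at hs
      exact (h0 s hs.2).1
  · refine intervalIntegral.integral_pos hz cφ.continuousOn (fun s _ => hφ0 s)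
      ⟨z, ⟨hz.le, le_rfl⟩, ?_⟩
    have : 0 < max z 0 := lt_max_of_lt_left hz
    simp only [hφ]
    positivity
  · calc ∫ s in (0:ℝ)..z, φ s ≤ ∫ _ in (0:ℝ)..z, (1:ℝ) :=
          intervalIntegral.integral_mono_on hz.le (cφ.intervalIntegrable _ _)
            intervalIntegrable_const fun s _ => hφ1 s
      _ = z := by simp
  · have : 0 ≤ max z 0 := le_max_right _ _
    simp only [hφ']
    positivity

namespace StripSol

variable {F Φ e b : ℝ → ℝ} {R ε η M b₀ K : ℝ} {u p v px pt vt : ℝ → ℝ → ℝ}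

/-- If `v = u_T` ever exceeds its initial bound, then the dissipation grows linearly. -/
theorem exists_dissipation_lower_bound (S : StripSol F Φ b R ε u p v px pt vt)
    (L : FluxLaw F Φ e η M) {db : ℝ → ℝ} (cdb : Continuous db)
    (hdb : ∀ Y ∈ Ioo 0 R, HasDerivAt b (db Y) Y)
    (hb : ∀ Y ∈ Icc 0 R, |b Y| ≤ b₀) (hK : 0 ≤ K) (hbK : b₀ ≤ K) (h0 : ∀ Y ∈ Icc 0 R, v 0 Y ≤ K)
    (hi : ∀ Y ∈ Ioc 0 R, b₀ + |F (p 0 Y)| / Y ≤ K) {C : ℝ}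
    (hu : ∀ T ≥ 0, ∀ Y ∈ Icc 0 R, u T Y ≤ C + K * T) {T₀ Y₀ : ℝ} (hT₀ : 0 < T₀)
    (hY₀ : Y₀ ∈ Icc 0 R) (hv : K < v T₀ Y₀) :
    ∃ a > 0, ∀ T ≥ T₀, a * (1 + T) ≤ ∫ y in (0:ℝ)..R, (y + ε) * v T y ^ 2 := by
  have hR := S.R_pos
  have hε := S.ε_pos
  have hη := L.η_pos
  have cF := S.continuous_F
  have cΦ := S.cΦ
  have ce := L.ce
  have cb := S.cb
  have cu := S.cu
  have cp := S.cp
  have cv := S.cv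
  have cpt := S.cpt
  have cvt := S.cvt
  obtain ⟨c, hc⟩ : ∃ c, c = (K + v T₀ Y₀) / 2 := ⟨_, rfl⟩
  obtain ⟨c', hc'⟩ : ∃ c', c' = (K + c) / 2 := ⟨_, rfl⟩
  obtain ⟨Bd, hBd⟩ := (isCompact_Icc (a := (0:ℝ)) (b := R)).exists_bound_of_continuousOn
    cdb.continuousOn
  have hBd0 : 0 ≤ Bd := (norm_nonneg _).trans (hBd 0 ⟨le_rfl, hR.le⟩)
  have hFη := L.F_nonneg η hη.le
  obtain ⟨A, k, hA, hk, hbar⟩ := L.exists_barrier (γ := c - K) (ε := ε) (B := Bd + F η / ε ^ 2)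
    (by linarith) hε (by positivity)
  set g : ℝ → ℝ := fun x => A * exp (-(k * x ^ 2)) with hg
  set g1 : ℝ → ℝ := fun x => A * exp (-(k * x ^ 2)) * (-(2 * k * x)) with hg1
  set g2 : ℝ → ℝ := fun x => A * exp (-(k * x ^ 2)) * (4 * k ^ 2 * x ^ 2 - 2 * k) with hg2
  have cg : Continuous g := by fun_prop
  have cg1 : Continuous g1 := by fun_prop
  have cg2 : Continuous g2 := by fun_prop
  have hgd : ∀ x, HasDerivAt g (g1 x) x := by
    intro x
    refine ((((hasDerivAt_pow 2 x).const_mul k).neg.exp).const_mul A).congr_deriv ?_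
    simp only [hg1, Pi.neg_apply]
    ring
  have hg1d : ∀ x, HasDerivAt g1 (g2 x) x := by
    intro x
    refine ((hgd x).mul ((hasDerivAt_id x).const_mul (2 * k)).neg).congr_deriv ?_
    simp only [hg1, hg2, hg, id, mul_one, Pi.neg_apply]
    ring
  have hgA : ∀ x, g x ≤ A := by
    intro x
    have : exp (-(k * x ^ 2)) ≤ 1 := exp_le_one_iff.2 (by have : 0 ≤ k * x ^ 2 := by positivity
                                                          linarith)
    simpa [hg] using mul_le_mul_of_nonneg_left this hA
  obtain ⟨θ, hθ⟩ : ∃ θ : ℝ → ℝ → ℝ, θ = fun t y => C + 1 + A + c' * t - u t y - g (p t y) :=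
    ⟨_, rfl⟩
  have hθ1 : ∀ T ≥ 0, ∀ Y ∈ Icc 0 R, 1 + (c' - K) * T ≤ θ T Y := by
    intro T hT Y hY
    have := hu T hT Y hY
    have := hgA (p T Y)
    simp only [hθ]
    linarith
  have hθ0 : 0 < θ T₀ Y₀ := by
    have := hθ1 T₀ hT₀.le Y₀ hY₀
    have : 0 ≤ (c' - K) * T₀ := mul_nonneg (by linarith) hT₀.le
    linarith
  obtain ⟨μ, hμ⟩ : ∃ μ, μ = (v T₀ Y₀ - c) / (2 * θ T₀ Y₀) := ⟨_, rfl⟩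
  have hμ0 : 0 < μ := by
    rw [hμ]
    exact div_pos (by linarith) (by linarith)
  obtain ⟨z, hz⟩ : ∃ z : ℝ → ℝ → ℝ, z = fun t y => v t y - c - μ * θ t y := ⟨_, rfl⟩
  have hz0 : 0 < z T₀ Y₀ := by
    have : μ * θ T₀ Y₀ = (v T₀ Y₀ - c) / 2 := by rw [hμ]; field_simp
    simp only [hz]
    linarith
  have cz : Continuous fun x : ℝ × ℝ => z x.1 x.2 := by
    simp only [hz, hθ]
    fun_prop
  have hzv : ∀ T ≥ 0, ∀ Y ∈ Icc 0 R, z T Y + c + μ * (1 + (c' - K) * T) ≤ v T Y := by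
    intro T hT Y hY
    have := mul_le_mul_of_nonneg_left (hθ1 T hT Y hY) hμ0.le
    have h1 : z T Y = v T Y - c - μ * θ T Y := by rw [hz]
    linarith
  have hzc : ∀ T ≥ 0, ∀ Y ∈ Icc 0 R, 0 ≤ z T Y → c ≤ v T Y := by
    intro T hT Y hY h
    have := hzv T hT Y hY
    have : 0 ≤ μ * (1 + (c' - K) * T) :=
      mul_nonneg hμ0.le (add_nonneg zero_le_one (mul_nonneg (by linarith) hT))
    linarith
  have hsup : ∀ T ≥ 0, ∀ Y ∈ Icc 0 R, c ≤ v T Y → η < |p T Y| := by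
    intro T hT Y hY h
    by_contra! hcon
    have := S.v_le_of_abs_p_le L hb hK hbK h0 hi hT hY hcon
    linarith
  obtain ⟨j, φ, φ', hj, hφ, cφ', hneg, hpos⟩ := exists_convex_cutoff
  have cj : Continuous j := continuous_iff_continuousAt.2 fun x => (hj x).continuousAt
  have cφ : Continuous φ := continuous_iff_continuousAt.2 fun x => (hφ x).continuousAt
  set I : ℝ → ℝ := fun t => ∫ y in (0:ℝ)..R, (y + ε) * j (z t y) with hI
  set zt : ℝ → ℝ → ℝ := fun t y => vt t y - μ * (c' - v t y - g1 (p t y) * pt t y) with hzt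
  have czt : Continuous fun x : ℝ × ℝ => zt x.1 x.2 := by fun_prop
  have hId : ∀ T > 0, HasDerivAt I (∫ y in (0:ℝ)..R, (y + ε) * (φ (z T y) * zt T y)) T := by
    intro T hT
    refine hasDerivAt_integral_of_continuous_strip (f := fun t y => (y + ε) * j (z t y))
      (ft := fun t y => (y + ε) * (φ (z t y) * zt t y)) hR.le (by fun_prop) (by fun_prop) ?_ hT
    intro t ht y hy
    refine HasDerivAt.const_mul (y + ε) (HasDerivAt.comp t (hj _) ?_)
    simp only [hz, hθ]
    refine (((S.v_t t ht y hy).sub_const c).sub (((((hasDerivAt_id t).const_mul c').const_add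
      (C + 1 + A)).sub (S.u_t t ht y hy)).sub ((hgd (p t y)).comp t (S.p_t t ht y hy))
        |>.const_mul μ)).congr_deriv ?_
    simp only [hzt]
    ring
  have hIn : ∀ T > 0, 0 ≤ ∫ y in (0:ℝ)..R, (y + ε) * (φ (z T y) * zt T y) := by
    intro T hT
    have cpT := S.continuous_p T
    have cvT := S.continuous_v T
    have cptT := S.continuous_pt T
    have cpxT := S.continuous_px T
    have cvtT := S.continuous_vt T
    have czT : Continuous (z T) := cz.comp (by fun_prop : Continuous fun y : ℝ => (T, y))
    have cztT : Continuous (zt T) := czt.comp (by fun_prop : Continuous fun y : ℝ => (T, y))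
    obtain ⟨q, hq⟩ : ∃ q : ℝ → ℝ, q = fun y => ∫ s in (0:ℝ)..y, (s + ε) * vt T s := ⟨_, rfl⟩
    have hqd : ∀ y, HasDerivAt q ((y + ε) * vt T y) y := fun y => by rw [hq]; exact S.flux_t_y y
    have cq : Continuous q := continuous_iff_continuousAt.2 fun x => (hqd x).continuousAt
    have hqeq : ∀ y ∈ Icc 0 R, q y = (y + ε) * (Φ (p T y) * pt T y) := fun y hy => by
      rw [hq]; exact (S.flux_t_eq_integral hT hy).symm
    set N : ℝ → ℝ := fun y => (y + ε) * (Φ (p T y) * p T y) +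
      g1 (p T y) * ((y + ε) * (v T y - b y) - F (p T y)) with hN
    set N' : ℝ → ℝ := fun y => Φ (p T y) * p T y +
      (y + ε) * (e (p T y) * px T y + Φ (p T y) * px T y) +
      (g2 (p T y) * px T y * ((y + ε) * (v T y - b y) - F (p T y)) + g1 (p T y) *
        (v T y - b y + (y + ε) * (pt T y - db y) - Φ (p T y) * px T y)) with hN'
    set zy : ℝ → ℝ := fun y => pt T y + μ * (p T y + g1 (p T y) * px T y) with hzy
    set H' : ℝ → ℝ := fun y => φ' (z T y) * zy y * (q y + μ * N y) +
      φ (z T y) * ((y + ε) * vt T y + μ * N' y) with hH'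
    have cH' : Continuous H' := by fun_prop
    have hzd : ∀ y ∈ Ioo 0 R, HasDerivAt (z T) (zy y) y := by
      intro y hy
      simp only [hz, hθ]
      refine (((S.v_y T hT y hy).sub_const c).sub ((((S.u_y T hT y hy).const_sub _).sub
        ((hgd (p T y)).comp y (S.p_y T hT y hy))).const_mul μ)).congr_deriv ?_
      simp only [hzy]
      ring
    have hNd : ∀ y ∈ Ioo 0 R, p T y ≠ 0 → HasDerivAt N (N' y) y := by
      intro y hy hp
      have hpd := S.p_y T hT y hy
      have hr := (hasDerivAt_id y).add_const ε
      refine ((hr.mul (((L.hΦ _ hp).comp y hpd).mul hpd)).add (((hg1d (p T y)).comp y hpd).mul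
        ((hr.mul ((S.v_y T hT y hy).sub (hdb y hy))).sub ((S.hF _).comp y hpd)))).congr_deriv ?_
      simp only [hN', id, Function.comp, Pi.sub_apply, Pi.mul_apply]
      field_simp
    have hHd : ∀ y ∈ Ioo 0 R, HasDerivAt (fun y => φ (z T y) * (q y + μ * N y)) (H' y) y := by
      intro y hy
      have hyI : y ∈ Icc 0 R := ⟨hy.1.le, hy.2.le⟩
      rcases lt_or_ge (z T y) 0 with hzy0 | hzy0
      · have h1 := hneg _ hzy0.le
        have h2 : H' y = 0 := by simp only [hH', h1]; ring
        rw [h2]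
        refine (hasDerivAt_const y (0:ℝ)).congr_of_eventuallyEq ?_
        filter_upwards [czT.continuousAt.eventually (gt_mem_nhds hzy0)] with x hx
        rw [(hneg _ (le_of_lt hx)).2.1, zero_mul]
      · have h1 := hsup T hT.le y hyI (hzc T hT.le y hyI hzy0)
        have hp : p T y ≠ 0 := abs_pos.1 (hη.trans h1)
        exact ((hφ _).comp y (hzd y hy)).mul ((hqd y).add ((hNd y hy hp).const_mul μ))
    have hbdry : ∀ y ∈ Icc 0 R, v T y ≤ K → φ (z T y) = 0 := by
      intro y hy hvy
      refine (hneg _ ?_).2.1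
      by_contra! hcon
      linarith [hzc T hT.le y hy hcon.le]
    have h0R : (0:ℝ) ∈ Icc 0 R := ⟨le_rfl, hR.le⟩
    have hH0 : ∫ y in (0:ℝ)..R, H' y = 0 := by
      rw [intervalIntegral.integral_eq_sub_of_hasDerivAt_of_le hR.le
        (f := fun y => φ (z T y) * (q y + μ * N y)) ?_ hHd (cH'.intervalIntegrable _ _)]
      · rw [hbdry R ⟨hR.le, le_rfl⟩ (by rw [S.v_R hT]; exact hK), hbdry 0 h0R
          (S.v_le_of_abs_p_le L hb hK hbK h0 hi hT.le h0R
            (by rw [S.p_zero T hT.le, abs_zero]; exact hη.le))]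
        ring
      · exact (by fun_prop : Continuous fun y => φ (z T y) * (q y + μ * N y)).continuousOn
    suffices h : 0 ≤ (∫ y in (0:ℝ)..R, (y + ε) * (φ (z T y) * zt T y)) - ∫ y in (0:ℝ)..R, H' y by
      rwa [hH0, sub_zero] at h
    rw [← intervalIntegral.integral_sub
      ((by fun_prop : Continuous fun y => (y + ε) * (φ (z T y) * zt T y)).intervalIntegrable _ _)
      (cH'.intervalIntegrable _ _)]
    refine intervalIntegral.integral_nonneg hR.le fun y hy => ?_
    rcases le_or_gt (z T y) 0 with hzy0 | hzy0
    · have h1 := hneg _ hzy0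
      simp only [hH', h1]
      apply le_of_eq
      ring
    · obtain ⟨-, -, hφ0, hφ'0⟩ := hpos _ hzy0
      have hvc := hzc T hT.le y hy hzy0.le
      have hpη := hsup T hT.le y hy hvc
      have hr : 0 < y + ε := by linarith [hy.1]
      have hrε : ε ≤ y + ε := by linarith [hy.1]
      have hflux := S.flux_le_of_le_abs_p L hb hK hbK h0 hi hT.le hy hpη.le
      have hpde := S.pde T hT y hy
      have hD : |db y - F (p T y) / (y + ε) ^ 2| ≤ Bd + F η / ε ^ 2 := by
        refine (abs_sub _ _).trans (add_le_add (hBd y hy) ?_)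
        rw [abs_div, abs_of_pos (by positivity : 0 < (y + ε) ^ 2)]
        have := L.F_le _ hpη.le
        gcongr
      have hQ := hbar (p T y) (-px T y) (v T y - c') (db y - F (p T y) / (y + ε) ^ 2) (y + ε) hpη
        (by linarith) (by linarith) hD hrε
      have hΦn := L.Φ_neg _ hpη
      have h1 : q y + μ * N y = (y + ε) * Φ (p T y) * zy y := by
        rw [hqeq y hy]
        simp only [hN, hzy]
        rw [hpde]
        field_simp
        ring
      have h2 : (y + ε) * (φ (z T y) * zt T y) - H' y =
          μ * φ (z T y) * (y + ε) * (v T y - c' + Φ (p T y) * -px T y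
            - Φ (p T y) * p T y / (y + ε) + e (p T y) * -px T y
            - g2 (p T y) * -px T y * (Φ (p T y) * -px T y)
            + g1 (p T y) * (db y - F (p T y) / (y + ε) ^ 2))
          + φ' (z T y) * ((y + ε) * (-Φ (p T y)) * zy y ^ 2) := by
        simp only [hH']
        rw [h1]
        simp only [hN', hzt]
        have hX : v T y - b y = Φ (p T y) * px T y + F (p T y) / (y + ε) := by linarith
        rw [hX]
        field_simp
        ring
      rw [h2]
      have h3 : 0 ≤ -Φ (p T y) := by linarith
      exact add_nonneg (mul_nonneg (by positivity) hQ) (by positivity)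
  have hmono : MonotoneOn I (Ici T₀) := by
    refine monotoneOn_of_hasDerivWithinAt_nonneg (convex_Ici T₀)
      (fun t ht => (hId t (hT₀.trans_le ht)).continuousAt.continuousWithinAt)
      (fun t ht => (hId t ?_).hasDerivWithinAt) fun t ht => hIn t ?_
    all_goals
      rw [interior_Ici] at ht
      exact hT₀.trans ht
  have hj0 : ∀ x, 0 ≤ j x := fun x => by
    rcases le_or_gt x 0 with h | h
    · exact (hneg x h).1.ge
    · exact (hpos x h).1.le
  have hI0 : 0 < I T₀ := by
    have czT : Continuous (z T₀) := cz.comp (by fun_prop : Continuous fun y : ℝ => (T₀, y))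
    refine intervalIntegral.integral_pos hR
      (by fun_prop : Continuous fun y => (y + ε) * j (z T₀ y)).continuousOn
      (fun y hy => mul_nonneg (by linarith [hy.1]) (hj0 _)) ⟨Y₀, hY₀, ?_⟩
    exact mul_pos (by linarith [hY₀.1]) (hpos _ hz0).1
  set m := min 1 (c' - K) with hm
  have hm0 : 0 < m := lt_min one_pos (by linarith)
  refine ⟨μ * m * I T₀, by positivity, fun T hT => ?_⟩
  have hT0 : 0 ≤ T := hT₀.le.trans hT
  have cvT := S.continuous_v T
  have czT : Continuous (z T) := cz.comp (by fun_prop : Continuous fun y : ℝ => (T, y))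
  calc μ * m * I T₀ * (1 + T) = μ * m * (1 + T) * I T₀ := by ring
    _ ≤ μ * m * (1 + T) * I T := by
        have := hmono self_mem_Ici hT hT
        gcongr
    _ = ∫ y in (0:ℝ)..R, μ * m * (1 + T) * ((y + ε) * j (z T y)) := by
        rw [intervalIntegral.integral_const_mul]
    _ ≤ ∫ y in (0:ℝ)..R, (y + ε) * v T y ^ 2 := by
        refine intervalIntegral.integral_mono_on hR.le
          ((by fun_prop : Continuous fun y =>
            μ * m * (1 + T) * ((y + ε) * j (z T y))).intervalIntegrable _ _)
          ((by fun_prop : Continuous fun y => (y + ε) * v T y ^ 2).intervalIntegrable _ _)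
          fun y hy => ?_
        have hr : 0 < y + ε := by linarith [hy.1]
        suffices h : μ * m * (1 + T) * j (z T y) ≤ v T y ^ 2 by
          calc μ * m * (1 + T) * ((y + ε) * j (z T y))
              = (y + ε) * (μ * m * (1 + T) * j (z T y)) := by ring
            _ ≤ (y + ε) * v T y ^ 2 := by gcongr
        rcases le_or_gt (z T y) 0 with h | h
        · rw [(hneg _ h).1, mul_zero]
          positivity
        · have h1 := hzv T hT0 y hy
          have h2 : m * (1 + T) ≤ 1 + (c' - K) * T := by
            have h3 : m * T ≤ (c' - K) * T := by gcongr; exact min_le_right _ _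
            have h4 : m ≤ 1 := min_le_left _ _
            linarith
          have h3 : μ * (m * (1 + T)) ≤ μ * (1 + (c' - K) * T) := by gcongr
          have h4 : 0 ≤ μ * (m * (1 + T)) := by positivity
          have h5 := (hpos _ h).2.1
          calc μ * m * (1 + T) * j (z T y) = μ * (m * (1 + T)) * j (z T y) := by ring
            _ ≤ v T y * v T y := by
                have := hj0 (z T y)
                apply mul_le_mul <;> linarith
            _ = v T y ^ 2 := by ring

end StripSol

namespace StripSol

variable {F Φ e b : ℝ → ℝ} {R ε η M b₀ K : ℝ} {u p v px pt vt : ℝ → ℝ → ℝ}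

theorem abs_u_le (S : StripSol F Φ b R ε u p v px pt vt) (L : FluxLaw F Φ e η M)
    (hb : ∀ Y ∈ Icc 0 R, |b Y| ≤ b₀) (hK : 0 ≤ K) (hbK : b₀ ≤ K)
    (h0 : ∀ Y ∈ Icc 0 R, |v 0 Y| ≤ K) (hi : ∀ Y ∈ Ioc 0 R, b₀ + |F (p 0 Y)| / Y ≤ K) :
    ∃ C, 0 ≤ C ∧ ∀ T ≥ 0, ∀ Y ∈ Icc 0 R, |u T Y| ≤ C + K * T := by
  have hη := L.η_pos
  obtain ⟨C₁, hC₁, h1⟩ := S.u_le hK fun T hT Y hY hp =>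
    S.v_le_of_abs_p_le L hb hK hbK (fun y hy => (abs_le.1 (h0 y hy)).2) hi hT.le hY
      (by rw [hp, abs_zero]; exact hη.le)
  have S' := S.neg L.F_odd L.Φ_even
  obtain ⟨C₂, hC₂, h2⟩ := S'.u_le hK fun T hT Y hY hp =>
    S'.v_le_of_abs_p_le L (by simpa using hb) hK hbK
      (fun y hy => by linarith [(abs_le.1 (h0 y hy)).1])
      (by simpa only [L.F_odd, abs_neg] using hi) hT.le hY (by rw [hp, abs_zero]; exact hη.le)
  refine ⟨C₁ + C₂, by positivity, fun T hT Y hY => abs_le.2 ⟨?_, ?_⟩⟩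
  · linarith [h2 T hT Y hY]
  · linarith [h1 T hT Y hY]

theorem v_le_of_fluxLaw (S : StripSol F Φ b R ε u p v px pt vt) (L : FluxLaw F Φ e η M)
    {db : ℝ → ℝ} (cdb : Continuous db) (hdb : ∀ Y ∈ Ioo 0 R, HasDerivAt b (db Y) Y)
    (hb : ∀ Y ∈ Icc 0 R, |b Y| ≤ b₀) (hK : 0 ≤ K) (hbK : b₀ ≤ K)
    (h0 : ∀ Y ∈ Icc 0 R, |v 0 Y| ≤ K) (hi : ∀ Y ∈ Ioc 0 R, b₀ + |F (p 0 Y)| / Y ≤ K)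
    {T Y : ℝ} (hT : 0 < T) (hY : Y ∈ Icc 0 R) : v T Y ≤ K := by
  by_contra! hcon
  obtain ⟨C, hC, hu⟩ := S.abs_u_le L hb hK hbK h0 hi
  obtain ⟨a, ha, hlow⟩ := S.exists_dissipation_lower_bound L cdb hdb hb hK hbK
    (fun y hy => (abs_le.1 (h0 y hy)).2) hi (fun t ht y hy => (abs_le.1 (hu t ht y hy)).2)
    hT hY hcon
  refine S.dissipation_not_growing L.F_odd L.F_nonneg (C := C + K) (fun t ht y hy => ?_) hT ha hlow
  have h1 : 0 ≤ C * t := by positivity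
  linarith [hu t ht y hy]

/-- The bound `|u_T| ≤ K` for a non-monotone flux law. -/
theorem abs_v_le_of_fluxLaw (S : StripSol F Φ b R ε u p v px pt vt) (L : FluxLaw F Φ e η M)
    {db : ℝ → ℝ} (cdb : Continuous db) (hdb : ∀ Y ∈ Ioo 0 R, HasDerivAt b (db Y) Y)
    (hb : ∀ Y ∈ Icc 0 R, |b Y| ≤ b₀) (hK : 0 ≤ K) (hbK : b₀ ≤ K)
    (h0 : ∀ Y ∈ Icc 0 R, |v 0 Y| ≤ K) (hi : ∀ Y ∈ Ioc 0 R, b₀ + |F (p 0 Y)| / Y ≤ K)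
    {T Y : ℝ} (hT : 0 < T) (hY : Y ∈ Icc 0 R) : |v T Y| ≤ K := by
  refine abs_le.2 ⟨?_, S.v_le_of_fluxLaw L cdb hdb hb hK hbK h0 hi hT hY⟩
  have := (S.neg L.F_odd L.Φ_even).v_le_of_fluxLaw L cdb.neg (fun y hy => (hdb y hy).neg)
    (by simpa using hb) hK hbK (by simpa using h0) (by simpa only [L.F_odd, abs_neg] using hi) hT hY
  linarith

/-- The bound `|u_T| ≤ K` for a monotone flux law. -/
theorem abs_v_le_of_forall_pos (S : StripSol F Φ b R ε u p v px pt vt) (hodd : ∀ x, F (-x) = -F x)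
    (heven : ∀ x, Φ (-x) = Φ x) (hΦ : ∀ x, 0 < Φ x) (hK : 0 ≤ K)
    (h0 : ∀ Y ∈ Icc 0 R, |v 0 Y| ≤ K) {T Y : ℝ} (hT : 0 < T) (hY : Y ∈ Icc 0 R) :
    |v T Y| ≤ K := by
  refine abs_le.2 ⟨?_, S.le_of_forall_pos hΦ hK (fun y hy => (abs_le.1 (h0 y hy)).2) hT.le hY⟩
  have := (S.neg hodd heven).le_of_forall_pos hΦ hK
    (fun y hy => by linarith [(abs_le.1 (h0 y hy)).1]) hT.le hY
  linarith

end StripSol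

namespace FluxLaw

variable {F Φ e : ℝ → ℝ} {η M : ℝ}

theorem const_mul (L : FluxLaw F Φ e η M) {c : ℝ} (hc : 0 < c) :
    FluxLaw (fun x => c * F x) (fun x => c * Φ x) (fun x => c * e x) η (c * M) where
  η_pos := L.η_pos
  Φ_pos x hx := mul_pos hc (L.Φ_pos x hx)
  Φ_neg x hx := mul_neg_of_pos_of_neg hc (L.Φ_neg x hx)
  Φ_eta x hx := by rw [L.Φ_eta x hx, mul_zero]
  Φ_le x := by
    rw [abs_mul, abs_of_pos hc]
    exact mul_le_mul_of_nonneg_left (L.Φ_le x) hc.le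
  e_le x := by
    rw [abs_mul, abs_of_pos hc]
    exact mul_le_mul_of_nonneg_left (L.e_le x) hc.le
  hΦ x hx := ((L.hΦ x hx).const_mul c).congr_deriv (by ring)
  ce := L.ce.const_mul c
  far δ hδ := by
    obtain ⟨A, hA⟩ := L.far (δ / c) (by positivity)
    refine ⟨A, fun x hx => ?_⟩
    obtain ⟨h1, h2⟩ := hA x hx
    rw [← mul_add, mul_assoc, abs_mul, abs_of_pos hc]
    rw [le_div_iff₀ hc] at h2
    exact ⟨mul_nonneg hc.le h1, by linarith⟩
  F_odd x := by rw [L.F_odd, mul_neg]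
  Φ_even x := by rw [L.Φ_even]
  F_nonneg x hx := mul_nonneg hc.le (L.F_nonneg x hx)
  F_le x hx := by
    rw [abs_mul, abs_of_pos hc]
    exact mul_le_mul_of_nonneg_left (L.F_le x hx) hc.le

end FluxLaw

/-- The Carreau–Yasuda flux `(1 + κ^α |x|^α)^{(n-1)/α} x`, an antiderivative of `Φ(|x|)`. -/
noncomputable def carreauFlux (α κ n x : ℝ) : ℝ :=
  (1 + κ ^ α * |x| ^ α) ^ ((n - 1) / α) * x

/-- The logarithmic derivative `x (d/dx) Φ(|x|)` of the Carreau–Yasuda viscosity. -/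
noncomputable def carreauRate (α κ n x : ℝ) : ℝ :=
  α * (κ ^ α * |x| ^ α) * (n * (1 + κ ^ α * |x| ^ α) ^ ((n - 1 - α) / α) +
    (n - 1 - α) / α * (1 + n * (κ ^ α * |x| ^ α)) *
      (1 + κ ^ α * |x| ^ α) ^ ((n - 1 - α) / α - 1))

section Carreau

variable {α κ n : ℝ}

theorem one_le_one_add_rpow_mul (hκ : 0 ≤ κ) (x : ℝ) : 1 ≤ 1 + κ ^ α * |x| ^ α := by
  have : 0 ≤ κ ^ α * |x| ^ α := by positivity
  linarith

theorem hasDerivAt_rpow_mul_abs_rpow {x : ℝ} (hx : x ≠ 0) :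
    HasDerivAt (fun x => κ ^ α * |x| ^ α) (α * (κ ^ α * |x| ^ α) / x) x := by
  have h := ((hasDerivAt_abs hx).rpow_const (p := α) (Or.inl (abs_ne_zero.2 hx))).const_mul (κ ^ α)
  refine h.congr_deriv ?_
  rw [rpow_sub_one (abs_ne_zero.2 hx)]
  rcases hx.lt_or_gt with h | h
  · rw [abs_of_neg h, sign_neg h]
    simp only [SignType.coe_neg_one]
    field_simp
  · rw [abs_of_pos h, sign_pos h]
    simp only [SignType.coe_one]
    field_simp

theorem continuous_rpow_mul_abs_rpow (hα : 0 < α) : Continuous fun x : ℝ => κ ^ α * |x| ^ α :=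
  (continuous_abs.rpow_const fun _ => Or.inr hα.le).const_mul _

theorem continuous_one_add_rpow (hα : 0 < α) (hκ : 0 ≤ κ) (s : ℝ) :
    Continuous fun x : ℝ => (1 + κ ^ α * |x| ^ α) ^ s :=
  (continuous_const.add (continuous_rpow_mul_abs_rpow hα)).rpow_const fun x =>
    Or.inl (zero_lt_one.trans_le (one_le_one_add_rpow_mul (α := α) hκ x)).ne'

theorem Phi_abs_eq (x : ℝ) : Phi α κ n |x| =
    (1 + n * (κ ^ α * |x| ^ α)) * (1 + κ ^ α * |x| ^ α) ^ ((n - 1 - α) / α) := by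
  rw [Phi, mul_assoc n]

theorem continuous_Phi_abs (hα : 0 < α) (hκ : 0 ≤ κ) : Continuous fun x => Phi α κ n |x| := by
  simp only [Phi_abs_eq]
  exact (continuous_const.add ((continuous_rpow_mul_abs_rpow hα).const_mul n)).mul
    (continuous_one_add_rpow hα hκ _)

theorem continuous_carreauRate (hα : 0 < α) (hκ : 0 ≤ κ) : Continuous (carreauRate α κ n) := by
  have h1 := continuous_rpow_mul_abs_rpow (κ := κ) hα
  have h2 := continuous_one_add_rpow (κ := κ) hα hκ ((n - 1 - α) / α)
  have h3 := continuous_one_add_rpow (κ := κ) hα hκ ((n - 1 - α) / α - 1)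
  unfold carreauRate
  fun_prop

theorem hasDerivAt_carreauFlux (hα : 0 < α) (hκ : 0 ≤ κ) (x : ℝ) :
    HasDerivAt (carreauFlux α κ n) (Phi α κ n |x|) x := by
  have hw := one_le_one_add_rpow_mul (α := α) hκ x
  rcases eq_or_ne x 0 with rfl | hx
  · have h := hasDerivAt_mul_of_eq_zero (hasDerivAt_id (0:ℝ)) rfl
      (continuous_one_add_rpow (κ := κ) hα hκ ((n - 1) / α)).continuousAt
    refine (h.congr_of_eventuallyEq (Eventually.of_forall fun y => ?_)).congr_deriv ?_
    · simp only [carreauFlux, id_eq, mul_comm]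
    · simp [Phi, zero_rpow hα.ne']
  · refine ((((hasDerivAt_rpow_mul_abs_rpow hx).const_add 1).rpow_const
      (p := (n - 1) / α) (Or.inl (by linarith))).mul (hasDerivAt_id x)).congr_deriv ?_
    have hs : (n - 1) / α = (n - 1 - α) / α + 1 := by field_simp; ring
    rw [Phi_abs_eq, hs, add_sub_cancel_right, rpow_add_one (by linarith), id_eq]
    field_simp
    ring

theorem hasDerivAt_Phi_abs (hκ : 0 ≤ κ) {x : ℝ} (hx : x ≠ 0) :
    HasDerivAt (fun x => Phi α κ n |x|) (carreauRate α κ n x / x) x := by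
  have hw := one_le_one_add_rpow_mul (α := α) hκ x
  simp only [Phi_abs_eq]
  have h := hasDerivAt_rpow_mul_abs_rpow (κ := κ) (α := α) hx
  refine (((h.const_mul n).const_add 1).mul ((h.const_add 1).rpow_const
      (p := (n - 1 - α) / α) (Or.inl (by linarith)))).congr_deriv ?_
  rw [carreauRate]
  ring

theorem carreauFlux_neg (x : ℝ) : carreauFlux α κ n (-x) = -carreauFlux α κ n x := by
  simp only [carreauFlux, abs_neg, mul_neg]

theorem abs_carreauFlux (hκ : 0 ≤ κ) (x : ℝ) : |carreauFlux α κ n x| = carreauFlux α κ n |x| := by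
  have hw := one_le_one_add_rpow_mul (α := α) hκ x
  rw [carreauFlux, carreauFlux, abs_mul, abs_abs, abs_of_nonneg (rpow_nonneg (by linarith) _)]

theorem Phi_abs_pos (hκ : 0 ≤ κ) (x : ℝ) (h : 0 < 1 + n * (κ ^ α * |x| ^ α)) :
    0 < Phi α κ n |x| := by
  have hw := one_le_one_add_rpow_mul (α := α) hκ x
  rw [Phi_abs_eq]
  exact mul_pos h (rpow_pos_of_pos (by linarith) _)

theorem abs_Phi_abs_le (hα : 0 < α) (hκ : 0 ≤ κ) (x : ℝ) :
    |(Phi α κ n |x|)| ≤ (1 + |n|) * (1 + κ ^ α * |x| ^ α) ^ ((n - 1) / α) := by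
  have hζ : 0 ≤ κ ^ α * |x| ^ α := by positivity
  have hs : (n - 1) / α = (n - 1 - α) / α + 1 := by field_simp; ring
  rw [Phi_abs_eq, hs, rpow_add_one (by linarith), abs_mul,
    abs_of_nonneg (rpow_nonneg (by linarith : 0 ≤ 1 + κ ^ α * |x| ^ α) _)]
  have h1 : |1 + n * (κ ^ α * |x| ^ α)| ≤ (1 + |n|) * (1 + κ ^ α * |x| ^ α) := by
    refine (abs_add_le _ _).trans ?_
    rw [abs_one, abs_mul, abs_of_nonneg hζ]
    nlinarith [abs_nonneg n]
  calc _ ≤ (1 + |n|) * (1 + κ ^ α * |x| ^ α) * (1 + κ ^ α * |x| ^ α) ^ ((n - 1 - α) / α) := by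
        gcongr
    _ = _ := by ring

theorem abs_carreauRate_le (hα : 0 < α) (hκ : 0 ≤ κ) (x : ℝ) :
    |carreauRate α κ n x| ≤ α * (|n| + |(n - 1 - α) / α| * (1 + |n|)) *
      (1 + κ ^ α * |x| ^ α) ^ ((n - 1) / α) := by
  have hζ : 0 ≤ κ ^ α * |x| ^ α := by positivity
  have hs : (n - 1) / α = (n - 1 - α) / α - 1 + 1 + 1 := by field_simp; ring
  rw [carreauRate]
  set s := (n - 1 - α) / α
  set ζ := κ ^ α * |x| ^ α
  have hw : 0 < 1 + ζ := by linarith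
  set W := (1 + ζ) ^ (s - 1) with hW
  have hW0 : 0 ≤ W := rpow_nonneg hw.le _
  have h2 : (1 + ζ) ^ s = W * (1 + ζ) := by rw [hW, ← rpow_add_one hw.ne', sub_add_cancel]
  rw [hs, rpow_add_one hw.ne', rpow_add_one hw.ne', h2, abs_mul, abs_mul, abs_of_pos hα,
    abs_of_nonneg hζ]
  have h1 : |1 + n * ζ| ≤ (1 + |n|) * (1 + ζ) := by
    refine (abs_add_le _ _).trans ?_
    rw [abs_one, abs_mul, abs_of_nonneg hζ]
    nlinarith [abs_nonneg n]
  have h3 : |n * (W * (1 + ζ)) + s * (1 + n * ζ) * W| ≤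
      (|n| + |s| * (1 + |n|)) * (W * (1 + ζ)) := by
    refine (abs_add_le _ _).trans ?_
    rw [abs_mul n, abs_mul _ W, abs_mul s, abs_of_nonneg hW0, abs_of_nonneg (mul_nonneg hW0 hw.le)]
    calc |n| * (W * (1 + ζ)) + |s| * |1 + n * ζ| * W
        ≤ |n| * (W * (1 + ζ)) + |s| * ((1 + |n|) * (1 + ζ)) * W := by gcongr
      _ = _ := by ring
  calc α * ζ * |n * (W * (1 + ζ)) + s * (1 + n * ζ) * W|
      ≤ α * (1 + ζ) * ((|n| + |s| * (1 + |n|)) * (W * (1 + ζ))) := by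
        gcongr
        linarith
    _ = _ := by ring

theorem Phi_add_carreauRate_nonneg (hα : 0 < α) (hκ : 0 ≤ κ) {x : ℝ}
    (h : |2 * n + α * n - α| ≤ n ^ 2 * (κ ^ α * |x| ^ α)) :
    0 ≤ Phi α κ n |x| + carreauRate α κ n x := by
  have hζ : 0 ≤ κ ^ α * |x| ^ α := by positivity
  rw [carreauRate, Phi_abs_eq]
  have hs : α * ((n - 1 - α) / α) = n - 1 - α := by field_simp
  set s := (n - 1 - α) / α
  set ζ := κ ^ α * |x| ^ α
  have hw : 0 < 1 + ζ := by linarith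
  have h2 : (1 + ζ) ^ s = (1 + ζ) ^ (s - 1) * (1 + ζ) := by
    rw [← rpow_add_one hw.ne', sub_add_cancel]
  have h3 : (1 + n * ζ) * (1 + ζ) ^ s + α * ζ * (n * (1 + ζ) ^ s +
      s * (1 + n * ζ) * (1 + ζ) ^ (s - 1)) =
      (1 + ζ) ^ (s - 1) * (1 + (2 * n + α * n - α) * ζ + n ^ 2 * ζ * ζ) := by
    rw [h2]
    linear_combination (1 + ζ) ^ (s - 1) * ζ * (1 + n * ζ) * hs
  rw [h3]
  have h4 := mul_le_mul_of_nonneg_right ((neg_le_abs _).trans h) hζ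
  exact mul_nonneg (rpow_nonneg hw.le _) (by linarith)

theorem abs_Phi_mul_le (hα : 0 < α) (hκ : 0 < κ) (hn : n < 1) {x : ℝ} (hx : x ≠ 0) :
    |(Phi α κ n |x|) * x| ≤ (1 + |n|) * κ⁻¹ * (κ * |x|) ^ n := by
  have hx' := abs_pos.2 hx
  have hκx : 0 < κ * |x| := by positivity
  have h1 : (1 + κ ^ α * |x| ^ α) ^ ((n - 1) / α) ≤ (κ * |x|) ^ (n - 1) := by
    have h2 : (κ * |x|) ^ (n - 1) = ((κ * |x|) ^ α) ^ ((n - 1) / α) := by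
      rw [← rpow_mul hκx.le]
      congr 1
      field_simp
    rw [h2, mul_rpow hκ.le hx'.le]
    refine rpow_le_rpow_of_nonpos (by positivity) (by linarith) ?_
    exact div_nonpos_of_nonpos_of_nonneg (by linarith) hα.le
  rw [abs_mul]
  calc |(Phi α κ n |x|)| * |x| ≤ (1 + |n|) * (κ * |x|) ^ (n - 1) * |x| := by
        have := abs_Phi_abs_le (n := n) hα hκ.le x
        gcongr
        exact this.trans (by gcongr)
    _ = (1 + |n|) * κ⁻¹ * (κ * |x|) ^ n := by
        rw [rpow_sub_one hκx.ne']
        field_simp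

/-- For `n < 0` the Carreau–Yasuda flux is not monotone. -/
theorem exists_fluxLaw_carreau (hα : 0 < α) (hκ : 0 < κ) (hn : n < 0) :
    ∃ η M, FluxLaw (carreauFlux α κ n) (fun x => Phi α κ n |x|) (carreauRate α κ n) η M := by
  have hn' : 0 < (-n)⁻¹ := inv_pos.2 (by linarith)
  set η : ℝ := (-n)⁻¹ ^ (1 / α) / κ with hη
  have hη0 : 0 < η := by positivity
  have hζη : κ ^ α * η ^ α = (-n)⁻¹ := by
    rw [← mul_rpow hκ.le hη0.le, hη, mul_div_cancel₀ _ hκ.ne', ← rpow_mul hn'.le,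
      one_div_mul_cancel hα.ne', rpow_one]
  have hcrit : 1 + n * (κ ^ α * η ^ α) = 0 := by
    have := hn.ne
    rw [hζη, ← neg_inv, mul_neg, mul_inv_cancel₀ hn.ne]
    ring
  have hpow : ∀ x : ℝ, 1 ≤ 1 + κ ^ α * |x| ^ α := one_le_one_add_rpow_mul hκ.le
  have hneg : ∀ x, η < |x| → Phi α κ n |x| < 0 := by
    intro x hx
    rw [Phi_abs_eq]
    refine mul_neg_of_neg_of_pos ?_ (rpow_pos_of_pos (by linarith [hpow x]) _)
    have h1 : κ ^ α * η ^ α < κ ^ α * |x| ^ α := by gcongr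
    linarith [mul_lt_mul_of_neg_left h1 hn]
  have hzero : ∀ x, |x| = η → Phi α κ n |x| = 0 := by
    intro x hx
    rw [Phi_abs_eq, hx, hcrit, zero_mul]
  have hle1 : ∀ x, (1 + κ ^ α * |x| ^ α) ^ ((n - 1) / α) ≤ 1 := fun x =>
    rpow_le_one_of_one_le_of_nonpos (hpow x)
      (div_nonpos_of_nonpos_of_nonneg (by linarith) hα.le)
  have hs : 0 ≤ |n| + |(n - 1 - α) / α| * (1 + |n|) := by positivity
  have hanti : AntitoneOn (carreauFlux α κ n) (Ici η) := by
    refine antitoneOn_of_hasDerivWithinAt_nonpos (convex_Ici η)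
      (fun x _ => (hasDerivAt_carreauFlux hα hκ.le x).continuousAt.continuousWithinAt)
      (fun x _ => (hasDerivAt_carreauFlux hα hκ.le x).hasDerivWithinAt) fun x hx => ?_
    rw [interior_Ici] at hx
    exact (hneg x ((show η < x from hx).trans_le (le_abs_self x))).le
  refine ⟨η, (1 + |n|) + α * (|n| + |(n - 1 - α) / α| * (1 + |n|)), ?_⟩
  refine ⟨hη0, fun x hx => Phi_abs_pos hκ.le x ?_, hneg, hzero, fun x => ?_, fun x => ?_,
    fun x hx => hasDerivAt_Phi_abs hκ.le hx, continuous_carreauRate hα hκ.le, fun δ hδ => ?_,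
    carreauFlux_neg, fun x => by rw [abs_neg], fun x hx => ?_, fun x hx => ?_⟩
  · have h1 : κ ^ α * |x| ^ α < κ ^ α * η ^ α := by gcongr
    linarith [mul_lt_mul_of_neg_left h1 hn]
  · have h1 : (1 + |n|) * (1 + κ ^ α * |x| ^ α) ^ ((n - 1) / α) ≤ (1 + |n|) * 1 := by
      gcongr
      exact hle1 x
    have h2 : 0 ≤ α * (|n| + |(n - 1 - α) / α| * (1 + |n|)) := by positivity
    linarith [abs_Phi_abs_le (n := n) hα hκ.le x]
  · have h1 := mul_le_mul_of_nonneg_left (hle1 x) (mul_nonneg hα.le hs)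
    linarith [abs_carreauRate_le (n := n) hα hκ.le x, abs_nonneg n]
  · have t1 : Tendsto (fun X : ℝ => n ^ 2 * (κ ^ α * X ^ α)) atTop atTop :=
      ((tendsto_rpow_atTop hα).const_mul_atTop (rpow_pos_of_pos hκ α)).const_mul_atTop
        (by have := hn.ne; positivity)
    have t2 : Tendsto (fun X : ℝ => (1 + |n|) * κ⁻¹ * (κ * X) ^ n) atTop (nhds 0) := by
      have h1 := (tendsto_rpow_neg_atTop (neg_pos.2 hn)).comp (tendsto_id.const_mul_atTop hκ)
      have h2 := h1.const_mul ((1 + |n|) * κ⁻¹)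
      rw [mul_zero] at h2
      refine h2.congr fun X => ?_
      simp
    obtain ⟨A, hA⟩ := eventually_atTop.1 ((t1.eventually_ge_atTop |2 * n + α * n - α|).and
      ((t2.eventually (gt_mem_nhds hδ)).and (eventually_gt_atTop 0)))
    refine ⟨A, fun x hx => ?_⟩
    obtain ⟨h1, h2, h3⟩ := hA _ hx
    exact ⟨Phi_add_carreauRate_nonneg hα hκ.le h1,
      (abs_Phi_mul_le hα hκ (by linarith) (abs_pos.1 h3)).trans (le_of_lt h2)⟩
  · exact mul_nonneg (rpow_nonneg (by linarith [hpow x]) _) hx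
  · rw [abs_carreauFlux hκ.le]
    exact hanti self_mem_Ici hx hx

end Carreau

section Strip

/-- Projection of the plane onto the closed strip `T ≥ 0`, `0 ≤ Y ≤ R`. -/
def stripProj (R : ℝ) (x : ℝ × ℝ) : ℝ × ℝ := (max x.1 0, max 0 (min R x.2))

theorem continuous_stripProj (R : ℝ) : Continuous (stripProj R) := by
  unfold stripProj
  fun_prop

theorem stripProj_mem {R : ℝ} (hR : 0 < R) (x : ℝ × ℝ) :
    stripProj R x ∈ Ici (0:ℝ) ×ˢ Icc 0 R :=
  ⟨mem_Ici.2 (le_max_right _ _), le_max_left _ _, max_le hR.le (min_le_left _ _)⟩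

theorem stripProj_of_mem {R T Y : ℝ} (hT : 0 ≤ T) (hY : Y ∈ Icc 0 R) :
    stripProj R (T, Y) = (T, Y) := by
  simp only [stripProj, max_eq_left hT, min_eq_right hY.2, max_eq_right hY.1]

theorem uniqueDiffOn_strip {R : ℝ} (hR : 0 < R) : UniqueDiffOn ℝ (Ici (0:ℝ) ×ˢ Icc 0 R) :=
  (uniqueDiffOn_Ici 0).prod (uniqueDiffOn_Icc hR)

/-- Directional derivative within the closed strip. -/
noncomputable def stripDeriv (R : ℝ) (w : ℝ × ℝ) (f : ℝ × ℝ → ℝ) (x : ℝ × ℝ) : ℝ :=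
  fderivWithin ℝ f (Ici (0:ℝ) ×ˢ Icc 0 R) x w

variable {R : ℝ} {f : ℝ × ℝ → ℝ}

theorem ContDiffOn.stripDeriv_one (hR : 0 < R)
    (hf : ContDiffOn ℝ 2 f (Ici (0:ℝ) ×ˢ Icc 0 R)) (w : ℝ × ℝ) :
    ContDiffOn ℝ 1 (stripDeriv R w f) (Ici (0:ℝ) ×ˢ Icc 0 R) :=
  (hf.fderivWithin (uniqueDiffOn_strip hR) (by norm_num)).clm_apply contDiffOn_const

theorem ContDiffOn.continuousOn_stripDeriv (hR : 0 < R)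
    (hf : ContDiffOn ℝ 1 f (Ici (0:ℝ) ×ˢ Icc 0 R)) (w : ℝ × ℝ) :
    ContinuousOn (stripDeriv R w f) (Ici (0:ℝ) ×ˢ Icc 0 R) :=
  (hf.continuousOn_fderivWithin (uniqueDiffOn_strip hR) le_rfl).clm_apply continuousOn_const

theorem continuous_comp_stripProj (hR : 0 < R)
    (hf : ContinuousOn f (Ici (0:ℝ) ×ˢ Icc 0 R)) : Continuous fun x => f (stripProj R x) :=
  hf.comp_continuous (continuous_stripProj R) (stripProj_mem hR)

theorem hasDerivWithinAt_stripDeriv_time (hf : ContDiffOn ℝ 1 f (Ici (0:ℝ) ×ˢ Icc 0 R))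
    {T Y : ℝ} (hT : 0 ≤ T) (hY : Y ∈ Icc 0 R) :
    HasDerivWithinAt (fun t => f (t, Y)) (stripDeriv R (1, 0) f (T, Y)) (Ici 0) T := by
  have h1 := (hf.differentiableOn one_ne_zero (T, Y) ⟨hT, hY⟩).hasFDerivWithinAt
  exact h1.comp_hasDerivWithinAt T
    ((hasDerivWithinAt_id T _).prodMk (hasDerivWithinAt_const T _ Y)) fun t ht => mk_mem_prod ht hY

theorem hasDerivWithinAt_stripDeriv_space (hf : ContDiffOn ℝ 1 f (Ici (0:ℝ) ×ˢ Icc 0 R))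
    {T Y : ℝ} (hT : 0 ≤ T) (hY : Y ∈ Icc 0 R) :
    HasDerivWithinAt (fun y => f (T, y)) (stripDeriv R (0, 1) f (T, Y)) (Icc 0 R) Y := by
  have h1 := (hf.differentiableOn one_ne_zero (T, Y) ⟨hT, hY⟩).hasFDerivWithinAt
  exact h1.comp_hasDerivWithinAt Y
    ((hasDerivWithinAt_const Y _ T).prodMk (hasDerivWithinAt_id Y _)) fun y hy => mk_mem_prod hT hy

theorem stripDeriv_stripDeriv (hR : 0 < R) (hf : ContDiffOn ℝ 2 f (Ici (0:ℝ) ×ˢ Icc 0 R))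
    (w w' : ℝ × ℝ) {x : ℝ × ℝ} (hx : x ∈ Ici (0:ℝ) ×ˢ Icc 0 R) :
    stripDeriv R w (stripDeriv R w' f) x =
      fderivWithin ℝ (fderivWithin ℝ f (Ici (0:ℝ) ×ˢ Icc 0 R)) (Ici (0:ℝ) ×ˢ Icc 0 R) x w w' := by
  have hs := uniqueDiffOn_strip hR
  have h1 := ((hf.fderivWithin (m := 1) hs (by norm_num)).differentiableOn one_ne_zero x hx)
  have h2 := (h1.hasFDerivWithinAt.clm_apply (hasFDerivWithinAt_const w' x _)).fderivWithin
    (hs x hx)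
  rw [stripDeriv]
  unfold stripDeriv
  rw [h2]
  simp

theorem stripDeriv_comm (hR : 0 < R) (hf : ContDiffOn ℝ 2 f (Ici (0:ℝ) ×ˢ Icc 0 R))
    (w w' : ℝ × ℝ) {x : ℝ × ℝ} (hx : x ∈ Ici (0:ℝ) ×ˢ Icc 0 R) :
    stripDeriv R w (stripDeriv R w' f) x = stripDeriv R w' (stripDeriv R w f) x := by
  rw [stripDeriv_stripDeriv hR hf _ _ hx, stripDeriv_stripDeriv hR hf _ _ hx]
  refine ((hf x hx).isSymmSndFDerivWithinAt (by simp) (uniqueDiffOn_strip hR) ?_ hx).eq w w'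
  rw [interior_prod_eq, interior_Ici, interior_Icc, closure_prod_eq, closure_Ioi,
    closure_Ioo hR.ne]
  exact hx

theorem hasDerivAt_comp_stripProj_time (hf : ContDiffOn ℝ 1 f (Ici (0:ℝ) ×ˢ Icc 0 R))
    {T Y : ℝ} (hT : 0 < T) (hY : Y ∈ Icc 0 R) :
    HasDerivAt (fun t => f (stripProj R (t, Y)))
      (stripDeriv R (1, 0) f (stripProj R (T, Y))) T := by
  rw [stripProj_of_mem hT.le hY]
  refine ((hasDerivWithinAt_stripDeriv_time hf hT.le hY).hasDerivAt
    (Ici_mem_nhds hT)).congr_of_eventuallyEq ?_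
  filter_upwards [lt_mem_nhds hT] with t ht
  rw [stripProj_of_mem (le_of_lt ht) hY]

theorem hasDerivAt_comp_stripProj_space (hf : ContDiffOn ℝ 1 f (Ici (0:ℝ) ×ˢ Icc 0 R))
    {T Y : ℝ} (hT : 0 ≤ T) (hY : Y ∈ Ioo 0 R) :
    HasDerivAt (fun y => f (stripProj R (T, y)))
      (stripDeriv R (0, 1) f (stripProj R (T, Y))) Y := by
  rw [stripProj_of_mem hT (Ioo_subset_Icc_self hY)]
  refine ((hasDerivWithinAt_stripDeriv_space hf hT (Ioo_subset_Icc_self hY)).hasDerivAt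
    (Icc_mem_nhds hY.1 hY.2)).congr_of_eventuallyEq ?_
  filter_upwards [Icc_mem_nhds hY.1 hY.2] with y hy
  rw [stripProj_of_mem hT hy]

end Strip

/-- A `C²` solution of the regularized problem, divided by `8β²` and extended to the plane. -/
theorem RegUnsteadySol.exists_stripSol {α β κ n R ε : ℝ} {b Ψ : ℝ → ℝ} {U : ℝ → ℝ → ℝ}
    (hα : 0 < α) (hβ : 0 < β) (hκ : 0 ≤ κ) (hR : 0 < R) (hε : 0 < ε)
    (hb : ContinuousOn b (Icc 0 R))
    (hU : ContDiffOn ℝ 2 (fun p : ℝ × ℝ => U p.1 p.2) (Ici 0 ×ˢ Icc 0 R))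
    (h : RegUnsteadySol α κ n β R ε b Ψ U) :
    ∃ u p v px pt vt, StripSol (fun x => (8 * β ^ 2)⁻¹ * carreauFlux α κ n x)
        (fun x => (8 * β ^ 2)⁻¹ * Phi α κ n |x|)
        (fun Y => (8 * β ^ 2)⁻¹ * b (max 0 (min R Y))) R ε u p v px pt vt ∧
      (∀ T ≥ 0, ∀ Y ∈ Icc 0 R, pT (Ici 0) U T Y = v T Y) ∧
      (∀ Y ∈ Icc 0 R, p 0 Y = derivWithin Ψ (Icc 0 R) Y) ∧
      ∀ Y ∈ Icc 0 R, v 0 Y = (8 * β ^ 2)⁻¹ *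
        (Phi α κ n |derivWithin Ψ (Icc 0 R) Y| *
            derivWithin (derivWithin Ψ (Icc 0 R)) (Icc 0 R) Y +
          carreauFlux α κ n (derivWithin Ψ (Icc 0 R) Y) / (Y + ε) + b Y) := by
  obtain ⟨hpde, hbc, hin⟩ := h
  set f : ℝ × ℝ → ℝ := fun p => U p.1 p.2 with hf
  have hu := uniqueDiffOn_Icc hR
  have hf1 : ContDiffOn ℝ 1 f (Ici (0:ℝ) ×ˢ Icc 0 R) := hU.of_le (by norm_num)
  have hg := hU.stripDeriv_one hR
  have ePT : ∀ T ≥ 0, ∀ Y ∈ Icc 0 R,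
      pT (Ici 0) U T Y = stripDeriv R (1, 0) f (T, Y) := fun T hT Y hY =>
    (hasDerivWithinAt_stripDeriv_time hf1 hT hY).derivWithin (uniqueDiffOn_Ici 0 T hT)
  have ePY : ∀ T ≥ 0, ∀ Y ∈ Icc 0 R,
      pY R U T Y = stripDeriv R (0, 1) f (T, Y) := fun T hT Y hY =>
    (hasDerivWithinAt_stripDeriv_space hf1 hT hY).derivWithin (hu Y hY)
  have ePYY : ∀ T ≥ 0, ∀ Y ∈ Icc 0 R,
      pYY R U T Y = stripDeriv R (0, 1) (stripDeriv R (0, 1) f) (T, Y) := fun T hT Y hY => by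
    rw [pYY, derivWithin_congr (fun y hy => ePY T hT y hy) (ePY T hT Y hY)]
    exact (hasDerivWithinAt_stripDeriv_space (hg _) hT hY).derivWithin (hu Y hY)
  have cp := continuous_comp_stripProj hR (hg (0, 1)).continuousOn
  have cv := continuous_comp_stripProj hR (hg (1, 0)).continuousOn
  have cpx := continuous_comp_stripProj hR ((hg (0, 1)).continuousOn_stripDeriv hR (0, 1))
  have cb : Continuous fun Y => b (max 0 (min R Y)) :=
    hb.comp_continuous (by fun_prop) fun Y => ⟨le_max_left _ _, max_le hR.le (min_le_left _ _)⟩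
  have cΦ := continuous_Phi_abs (n := n) hα hκ
  have cF : Continuous (carreauFlux α κ n) :=
    continuous_iff_continuousAt.2 fun x => (hasDerivAt_carreauFlux hα hκ x).continuousAt
  have key : EqOn
      (fun x : ℝ × ℝ => (x.2 + ε) * stripDeriv R (1, 0) f (stripProj R x))
      (fun x : ℝ × ℝ => (8 * β ^ 2)⁻¹ * ((x.2 + ε) *
        (Phi α κ n |stripDeriv R (0, 1) f (stripProj R x)| *
          stripDeriv R (0, 1) (stripDeriv R (0, 1) f) (stripProj R x)) +
        carreauFlux α κ n (stripDeriv R (0, 1) f (stripProj R x)) +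
        (x.2 + ε) * b (max 0 (min R x.2)))) (Ici (0:ℝ) ×ˢ Icc 0 R) := by
    have hcl : Ici (0:ℝ) ×ˢ Icc 0 R = closure (Ioi (0:ℝ) ×ˢ Ioo 0 R) := by
      rw [closure_prod_eq, closure_Ioi, closure_Ioo hR.ne]
    rw [hcl]
    refine EqOn.closure ?_ (by fun_prop) ?_
    · rintro ⟨T, Y⟩ ⟨hT, hY⟩
      have hT' : 0 < T := hT
      have hY' := Ioo_subset_Icc_self hY
      have h1 := hpde T hT' Y hY
      have hr : Y + ε ≠ 0 := by linarith [hY.1]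
      rw [ePT T hT'.le Y hY', ePY T hT'.le Y hY', ePYY T hT'.le Y hY', sub_sub,
        sub_eq_iff_eq_add] at h1
      simp only [stripProj_of_mem hT'.le hY', min_eq_right hY'.2, max_eq_right hY'.1]
      rw [eq_inv_mul_iff_mul_eq₀ (by positivity), carreauFlux,
        mul_left_comm, h1]
      field_simp
      ring
    · have h1 : Continuous fun x : ℝ × ℝ => b (max 0 (min R x.2)) := cb.comp continuous_snd
      have h2 := cΦ.comp cp
      have h3 := cF.comp cp
      exact continuous_const.mul ((((continuous_snd.add continuous_const).mul (h2.mul cpx)).add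
        h3).add ((continuous_snd.add continuous_const).mul h1))
  have hpde' : ∀ T ≥ 0, ∀ Y ∈ Icc 0 R, stripDeriv R (1, 0) f (T, Y) =
      (8 * β ^ 2)⁻¹ * (Phi α κ n |stripDeriv R (0, 1) f (T, Y)| *
          stripDeriv R (0, 1) (stripDeriv R (0, 1) f) (T, Y) +
        carreauFlux α κ n (stripDeriv R (0, 1) f (T, Y)) / (Y + ε) + b Y) := by
    intro T hT Y hY
    have h1 := key (show (T, Y) ∈ Ici (0:ℝ) ×ˢ Icc 0 R from ⟨hT, hY⟩)
    simp only [stripProj_of_mem hT hY, min_eq_right hY.2, max_eq_right hY.1] at h1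
    have hr : 0 < Y + ε := by linarith [hY.1]
    rw [← mul_right_inj' hr.ne', h1]
    field_simp
  have eΨ : ∀ Y ∈ Icc 0 R, derivWithin Ψ (Icc 0 R) Y = stripDeriv R (0, 1) f (0, Y) :=
    fun Y hY => by
      rw [← ePY 0 le_rfl Y hY, pY, derivWithin_congr (fun y hy => (hin y hy).symm) (hin Y hY).symm]
  have eΨΨ : ∀ Y ∈ Icc 0 R, derivWithin (derivWithin Ψ (Icc 0 R)) (Icc 0 R) Y =
      stripDeriv R (0, 1) (stripDeriv R (0, 1) f) (0, Y) := fun Y hY => by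
    rw [derivWithin_congr eΨ (eΨ Y hY)]
    exact (hasDerivWithinAt_stripDeriv_space (hg _) le_rfl hY).derivWithin (hu Y hY)
  refine ⟨fun T Y => f (stripProj R (T, Y)),
    fun T Y => stripDeriv R (0, 1) f (stripProj R (T, Y)),
    fun T Y => stripDeriv R (1, 0) f (stripProj R (T, Y)),
    fun T Y => stripDeriv R (0, 1) (stripDeriv R (0, 1) f) (stripProj R (T, Y)),
    fun T Y => stripDeriv R (1, 0) (stripDeriv R (0, 1) f) (stripProj R (T, Y)),
    fun T Y => stripDeriv R (1, 0) (stripDeriv R (1, 0) f) (stripProj R (T, Y)), ?_, ?_, ?_, ?_⟩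
  · exact {
      R_pos := hR
      ε_pos := hε
      hF := fun x => (hasDerivAt_carreauFlux hα hκ x).const_mul _
      F_zero := by simp [carreauFlux]
      cΦ := cΦ.const_mul _
      cb := cb.const_mul _
      cu := continuous_comp_stripProj hR hU.continuousOn
      cp := cp
      cv := cv
      cpx := cpx
      cpt := continuous_comp_stripProj hR ((hg (0, 1)).continuousOn_stripDeriv hR (1, 0))
      cvt := continuous_comp_stripProj hR ((hg (1, 0)).continuousOn_stripDeriv hR (1, 0))
      u_t := fun T hT Y hY => hasDerivAt_comp_stripProj_time hf1 hT hY
      p_t := fun T hT Y hY => hasDerivAt_comp_stripProj_time (hg _) hT hY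
      v_t := fun T hT Y hY => hasDerivAt_comp_stripProj_time (hg _) hT hY
      u_y := fun T hT Y hY => hasDerivAt_comp_stripProj_space hf1 (le_of_lt hT) hY
      p_y := fun T hT Y hY => hasDerivAt_comp_stripProj_space (hg _) (le_of_lt hT) hY
      v_y := fun T hT Y hY =>
        (hasDerivAt_comp_stripProj_space (hg _) (le_of_lt hT) hY).congr_deriv
          (stripDeriv_comm hR hU _ _ (stripProj_mem hR _))
      pde := fun T hT Y hY => by
        simp only [stripProj_of_mem (le_of_lt hT) hY, min_eq_right hY.2, max_eq_right hY.1]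
        rw [hpde' T (le_of_lt hT) Y hY]
        ring
      p_zero := fun T hT => by
        have h0 : (0:ℝ) ∈ Icc 0 R := ⟨le_rfl, hR.le⟩
        rw [stripProj_of_mem hT h0, ← ePY T hT 0 h0]
        exact (hbc T hT).1
      u_R := fun T hT => by
        rw [stripProj_of_mem hT ⟨hR.le, le_rfl⟩]
        exact (hbc T hT).2 }
  · exact fun T hT Y hY => by simp only [stripProj_of_mem hT hY, ePT T hT Y hY]
  · exact fun Y hY => by simp only [stripProj_of_mem le_rfl hY, eΨ Y hY]
  · exact fun Y hY => by
      simp only [stripProj_of_mem le_rfl hY, eΨΨ Y hY, eΨ Y hY, hpde' 0 le_rfl Y hY]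

theorem bddAbove_carreau_mul_abs_div {α κ n R : ℝ} {ψ : ℝ → ℝ} (hα : 0 < α) (hκ : 0 ≤ κ)
    (hR : 0 < R) (hψ : ContDiffOn ℝ 1 ψ (Icc 0 R)) (h0 : ψ 0 = 0) :
    BddAbove ((fun Y => (1 + κ ^ α * |ψ Y| ^ α) ^ ((n - 1) / α) * |ψ Y / Y|) '' Ioc 0 R) := by
  have hu := uniqueDiffOn_Icc hR
  obtain ⟨A, hA⟩ := isCompact_Icc.exists_bound_of_continuousOn
    ((continuous_one_add_rpow hα hκ ((n - 1) / α)).comp_continuousOn hψ.continuousOn)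
  obtain ⟨B, hB⟩ := isCompact_Icc.exists_bound_of_continuousOn
    (hψ.continuousOn_derivWithin hu le_rfl)
  refine ⟨A * B, ?_⟩
  rintro _ ⟨Y, hY, rfl⟩
  have hY' := Ioc_subset_Icc_self hY
  have h1 := (convex_Icc 0 R).norm_image_sub_le_of_norm_derivWithin_le
    (hψ.differentiableOn one_ne_zero) hB ⟨le_rfl, hR.le⟩ hY'
  rw [h0, sub_zero, sub_zero, norm_eq_abs, norm_eq_abs, abs_of_pos hY.1] at h1
  have h2 := (le_abs_self _).trans (hA Y hY')
  have h3 : |ψ Y / Y| ≤ B := by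
    rwa [abs_div, abs_of_pos hY.1, div_le_iff₀ hY.1]
  exact mul_le_mul h2 h3 (abs_nonneg _) ((abs_nonneg _).trans (hA Y hY'))

/-- Lemma 3.3: for `α > 0`, `β > 0`, `n ∈ ℝ`, `κ ≥ 0`, `ε ∈ (0,ε₀]`,
any solution `U^ε ∈ C³(Q) ∩ C²(Q̄)` of the regularized unsteady problem satisfies
`|U^ε_T(T,Y)| ≤ K₂` for all `T ≥ 0`, `Y ∈ [0,R]`, where
`K₂ = (1/(8β²))[ sup_{[0,R]} |Φ(|Ψ'|)Ψ''| + sup_{(0,R]} (1+κ^α|Ψ'|^α)^{(n−1)/α}|Ψ'/Y| + b₀ ]`. -/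
theorem stmt10 (α β κ n R b₀ ε₀ ε : ℝ) (b Ψ : ℝ → ℝ) (U : ℝ → ℝ → ℝ)
    (hα : 0 < α) (hβ : 0 < β) (hκ : 0 ≤ κ)
    (hR : 0 < R) (hε₀ : 0 < ε₀) (hε₀R : ε₀ < R) (hε : ε ∈ Ioc 0 ε₀)
    (hb : ContDiffOn ℝ 2 b (Icc 0 R))
    (hbb : ∀ Y ∈ Icc 0 R, 0 ≤ b Y ∧ b Y ≤ b₀)
    (hΨ : ContDiffOn ℝ 4 Ψ (Icc 0 R)) (hΨc : PsiCompat R b Ψ)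
    (hreg3 : ContDiffOn ℝ 3 (fun p : ℝ × ℝ => U p.1 p.2) (Ioi 0 ×ˢ Ioo 0 R))
    (hreg2 : ContDiffOn ℝ 2 (fun p : ℝ × ℝ => U p.1 p.2) (Ici 0 ×ˢ Icc 0 R))
    (hsol : RegUnsteadySol α κ n β R ε b Ψ U) :
    ∀ K₂, K₂ = (1 / (8 * β ^ 2)) *
        (sSup ((fun Y => |Phi α κ n |derivWithin Ψ (Icc 0 R) Y| *
            derivWithin (derivWithin Ψ (Icc 0 R)) (Icc 0 R) Y|) '' Icc 0 R) +
          sSup ((fun Y => (1 + κ ^ α * |derivWithin Ψ (Icc 0 R) Y| ^ α) ^ ((n - 1) / α) *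
            |derivWithin Ψ (Icc 0 R) Y / Y|) '' Ioc 0 R) + b₀) →
      ∀ T ≥ 0, ∀ Y ∈ Icc 0 R, |pT (Ici 0) U T Y| ≤ K₂ := by
  rintro K₂ hK₂
  obtain ⟨u, p, v, px, pt, vt, S, hv, hp0, hv0⟩ :=
    hsol.exists_stripSol hα hβ hκ hR hε.1 hb.continuousOn hreg2
  have hu := uniqueDiffOn_Icc hR
  have hΨ1 : ContDiffOn ℝ 1 (derivWithin Ψ (Icc 0 R)) (Icc 0 R) :=
    hΨ.derivWithin hu (by norm_num)
  set ψ := derivWithin Ψ (Icc 0 R) with hψ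
  have hψ0 : ψ 0 = 0 := hΨc.1
  set S₁ := sSup ((fun Y => |Phi α κ n |ψ Y| * derivWithin ψ (Icc 0 R) Y|) '' Icc 0 R)
  set S₂ := sSup ((fun Y => (1 + κ ^ α * |ψ Y| ^ α) ^ ((n - 1) / α) * |ψ Y / Y|) '' Ioc 0 R)
  have hS₁ : ∀ Y ∈ Icc 0 R, |Phi α κ n |ψ Y| * derivWithin ψ (Icc 0 R) Y| ≤ S₁ := fun Y hY =>
    le_csSup (isCompact_Icc.bddAbove_image
      (((continuous_Phi_abs hα hκ).comp_continuousOn hΨ1.continuousOn).mul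
        (hΨ1.continuousOn_derivWithin hu le_rfl)).abs) (mem_image_of_mem _ hY)
  have hS₂ : ∀ Y ∈ Ioc 0 R, |carreauFlux α κ n (ψ Y)| / Y ≤ S₂ := fun Y hY => by
    have h1 : |carreauFlux α κ n (ψ Y)| / Y =
        (1 + κ ^ α * |ψ Y| ^ α) ^ ((n - 1) / α) * |ψ Y / Y| := by
      rw [abs_carreauFlux hκ, carreauFlux, abs_abs, abs_div, abs_of_pos hY.1, mul_div_assoc]
    rw [h1]
    exact le_csSup (bddAbove_carreau_mul_abs_div hα hκ hR hΨ1 hψ0) (mem_image_of_mem _ hY)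
  have h0R : (0:ℝ) ∈ Icc 0 R := ⟨le_rfl, hR.le⟩
  have hS₁0 : 0 ≤ S₁ := (abs_nonneg _).trans (hS₁ 0 h0R)
  have hS₂0 : 0 ≤ S₂ := (by positivity : (0:ℝ) ≤ _).trans (hS₂ R ⟨hR, le_rfl⟩)
  have hb₀ : 0 ≤ b₀ := (hbb 0 h0R).1.trans (hbb 0 h0R).2
  have hB : 0 < (8 * β ^ 2)⁻¹ := by positivity
  rw [one_div] at hK₂
  have hbK : (8 * β ^ 2)⁻¹ * b₀ ≤ K₂ := by
    rw [hK₂]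
    exact mul_le_mul_of_nonneg_left (by linarith) hB.le
  have hK : 0 ≤ K₂ := (mul_nonneg hB.le hb₀).trans hbK
  have hinit : ∀ Y ∈ Icc 0 R, |v 0 Y| ≤ K₂ := by
    intro Y hY
    rw [hv0 Y hY, abs_mul, abs_of_pos hB, hK₂]
    refine mul_le_mul_of_nonneg_left ?_ hB.le
    have h1 : |carreauFlux α κ n (ψ Y) / (Y + ε)| ≤ S₂ := by
      rcases hY.1.eq_or_lt with rfl | hY0
      · simpa [hψ0, carreauFlux] using hS₂0
      · rw [abs_div, abs_of_pos (by linarith [hε.1] : 0 < Y + ε)]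
        refine le_trans ?_ (hS₂ Y ⟨hY0, hY.2⟩)
        gcongr
        linarith [hε.1]
    have h2 : |b Y| ≤ b₀ := by
      rw [abs_of_nonneg (hbb Y hY).1]
      exact (hbb Y hY).2
    exact (abs_add_le _ _).trans (add_le_add ((abs_add_le _ _).trans (add_le_add (hS₁ Y hY) h1)) h2)
  intro T hT Y hY
  rw [hv T hT Y hY]
  rcases (show 0 ≤ T from hT).eq_or_lt with rfl | hT0
  · exact hinit Y hY
  by_cases hcase : n < 0 ∧ 0 < κ
  · obtain ⟨η, M, L⟩ := exists_fluxLaw_carreau hα hcase.2 hcase.1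
    have cdb : Continuous fun Y => derivWithin b (Icc 0 R) (max 0 (min R Y)) :=
      (hb.continuousOn_derivWithin hu (by norm_num)).comp_continuous (by fun_prop) fun Y =>
        ⟨le_max_left _ _, max_le hR.le (min_le_left _ _)⟩
    refine S.abs_v_le_of_fluxLaw (L.const_mul hB) (cdb.const_mul (8 * β ^ 2)⁻¹) ?_
      (b₀ := (8 * β ^ 2)⁻¹ * b₀) ?_ hK hbK hinit ?_ hT0 hY
    · intro y hy
      have hy' := Ioo_subset_Icc_self hy
      simp only [min_eq_right hy'.2, max_eq_right hy'.1]
      refine ((((hb.differentiableOn two_ne_zero y hy').hasDerivWithinAt.hasDerivAt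
        (Icc_mem_nhds hy.1 hy.2)).congr_of_eventuallyEq ?_).const_mul _)
      filter_upwards [Icc_mem_nhds hy.1 hy.2] with z hz
      rw [min_eq_right hz.2, max_eq_right hz.1]
    · intro y hy
      rw [min_eq_right hy.2, max_eq_right hy.1, abs_mul, abs_of_pos hB,
        abs_of_nonneg (hbb y hy).1]
      exact mul_le_mul_of_nonneg_left (hbb y hy).2 hB.le
    · intro y hy
      rw [hp0 y (Ioc_subset_Icc_self hy), abs_mul, abs_of_pos hB, mul_div_assoc, ← mul_add, hK₂]
      exact mul_le_mul_of_nonneg_left (by linarith [hS₂ y hy]) hB.le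
  · refine S.abs_v_le_of_forall_pos (fun x => by rw [carreauFlux_neg, mul_neg])
      (fun x => by rw [abs_neg]) (fun x => mul_pos hB (Phi_abs_pos hκ x ?_)) hK hinit hT0 hY
    have hζ : 0 ≤ κ ^ α * |x| ^ α := by positivity
    rcases le_or_gt 0 n with hn | hn
    · linarith [mul_nonneg hn hζ]
    · have hκ0 : κ = 0 := le_antisymm (not_lt.1 fun h => hcase ⟨hn, h⟩) hκ
      simp [hκ0, zero_rpow hα.ne']
end

section
/- (Lemma 3.4) Suppose α > 0, β > 0, n ∈ ℝ, κ ≥ 0, ε ∈ (0, ε₀], and let U^ε ∈ C³(Q) ∩ C²(Q̄) be a solution of the regularized unsteady problem, satisfying |∂U^ε/∂T| ≤ K₂ on Q̄ (as in Lemma 3.3). Set K₃ = b₀/2 + 4β²K₂. Then (1 + κ^α |∂U^ε/∂Y(T,Y)|^α)^{(n−1)/α} |∂U^ε/∂Y(T,Y)| ≤ K₃ (Y + ε) for all T ≥ 0 and Y ∈ [0,R]. -/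
open Set Filter Real intervalIntegral

/-- The flux `v ↦ (1 + κ^α |v|^α)^{(n−1)/α} v` has derivative `Φ(|v|)`. -/
theorem hasDerivAt_flux (α κ n : ℝ) (hα : 0 < α) (hκ : 0 ≤ κ) (v : ℝ) :
    HasDerivAt (fun v : ℝ => (1 + κ ^ α * |v| ^ α) ^ ((n - 1) / α) * v) (Phi α κ n |v|) v := by
  have hk : 0 ≤ κ ^ α := rpow_nonneg hκ α
  have pos : ∀ w : ℝ, 0 < w → HasDerivAt
      (fun v : ℝ => (1 + κ ^ α * |v| ^ α) ^ ((n - 1) / α) * v) (Phi α κ n |w|) w := by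
    intro w hw
    have hbase : 0 < 1 + κ ^ α * w ^ α := by positivity
    have h1 : HasDerivAt (fun v : ℝ => 1 + κ ^ α * v ^ α) (κ ^ α * (α * w ^ (α - 1))) w :=
      ((hasDerivAt_rpow_const (Or.inl hw.ne')).const_mul _).const_add _
    have h2 := (h1.rpow_const (p := (n - 1) / α) (Or.inl hbase.ne')).mul (hasDerivAt_id w)
    have h3 : HasDerivAt (fun v : ℝ => (1 + κ ^ α * v ^ α) ^ ((n - 1) / α) * v)
        (Phi α κ n |w|) w := by
      refine h2.congr_deriv ?_
      have e1 : (n - 1) / α - 1 = (n - 1 - α) / α := by field_simp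
      have e2 : (1 + κ ^ α * w ^ α) ^ ((n - 1) / α)
          = (1 + κ ^ α * w ^ α) ^ ((n - 1 - α) / α) * (1 + κ ^ α * w ^ α) := by
        rw [← e1, rpow_sub_one hbase.ne']
        field_simp
      have e3 : w ^ (α - 1) * w = w ^ α := by
        rw [rpow_sub_one hw.ne']
        field_simp
      rw [Phi, abs_of_pos hw, e1, e2, id_eq, ← e3]
      field_simp
      ring
    refine h3.congr_of_eventuallyEq ?_
    filter_upwards [lt_mem_nhds hw] with x hx
    rw [abs_of_pos hx]
  rcases lt_trichotomy v 0 with hv | rfl | hv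
  · have h := ((pos (-v) (neg_pos.2 hv)).comp v (hasDerivAt_neg v)).neg
    simpa [Function.comp_def, Pi.neg_def] using h
  · have hc : ContinuousAt (fun v : ℝ => (1 + κ ^ α * |v| ^ α) ^ ((n - 1) / α)) 0 := by
      have : ContinuousAt (fun v : ℝ => 1 + κ ^ α * |v| ^ α) 0 :=
        ((continuousAt_id.abs.rpow_const (Or.inr hα.le)).const_mul _).const_add _
      exact this.rpow_const (Or.inl (by simp [zero_rpow hα.ne']))
    rw [hasDerivAt_iff_tendsto_slope]
    have h0 : Phi α κ n |0| = (1 + κ ^ α * |(0 : ℝ)| ^ α) ^ ((n - 1) / α) := by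
      simp [Phi, zero_rpow hα.ne']
    rw [h0]
    refine (hc.tendsto.mono_left nhdsWithin_le_nhds).congr' ?_
    filter_upwards [self_mem_nhdsWithin] with x hx
    have hx' : x ≠ 0 := hx
    simp [slope_def_field, hx']
  · exact pos v hv

/-- If `F(0) = 0` and `|F'(Y)| ≤ 2K(Y+ε)` on `(0,R)`, then `|F(Y)| ≤ K(Y+ε)²` on `[0,R]`. -/
theorem abs_le_mul_sq_of_abs_deriv_le {R ε K : ℝ} {F F' : ℝ → ℝ} (hK : 0 ≤ K)
    (hFc : ContinuousOn F (Icc 0 R)) (hF0 : F 0 = 0)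
    (hF : ∀ Y ∈ Ioo 0 R, HasDerivAt F (F' Y) Y)
    (hF' : ∀ Y ∈ Ioo 0 R, |F' Y| ≤ 2 * K * (Y + ε)) :
    ∀ Y ∈ Icc 0 R, |F Y| ≤ K * (Y + ε) ^ 2 := by
  intro Y hY
  have hq : ∀ y : ℝ, HasDerivAt (fun y => K * (y + ε) ^ 2) (2 * K * (y + ε)) y := fun y =>
    ((((hasDerivAt_id y).add_const ε).pow 2).const_mul K).congr_deriv (by simp; ring)
  have h0 : (0 : ℝ) ∈ Icc 0 R := ⟨le_rfl, hY.1.trans hY.2⟩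
  have key : ∀ s : ℝ, |s| = 1 → s * F Y ≤ K * (Y + ε) ^ 2 := by
    intro s hs
    have hm : MonotoneOn (fun y => K * (y + ε) ^ 2 - s * F y) (Icc 0 R) := by
      refine monotoneOn_of_hasDerivWithinAt_nonneg
        (f' := fun y => 2 * K * (y + ε) - s * F' y) (convex_Icc 0 R)
        (ContinuousOn.sub (by fun_prop) (hFc.const_mul s)) ?_ ?_
      · intro y hy
        rw [interior_Icc] at hy
        exact ((hq y).sub ((hF y hy).const_mul s)).hasDerivWithinAt
      · intro y hy
        rw [interior_Icc] at hy
        have h1 := le_abs_self (s * F' y)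
        rw [abs_mul, hs, one_mul] at h1
        linarith [hF' y hy]
    have h := hm h0 hY hY.1
    simp only [hF0, mul_zero, sub_zero, zero_add] at h
    nlinarith [mul_nonneg hK (sq_nonneg ε)]
  rw [abs_le]
  constructor
  · linarith [key (-1) (by simp)]
  · linarith [key 1 (by simp)]

/-- The radial derivative of a `C¹` function on `[0,∞) × [0,R]` is continuous in time. -/
theorem continuousOn_pY_time {R : ℝ} (hR : 0 < R) {U : ℝ → ℝ → ℝ}
    (hU : ContDiffOn ℝ 1 (fun p : ℝ × ℝ => U p.1 p.2) (Ici 0 ×ˢ Icc 0 R))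
    {Y : ℝ} (hY : Y ∈ Icc 0 R) : ContinuousOn (fun T => pY R U T Y) (Ici 0) := by
  have hud : UniqueDiffOn ℝ ((Ici 0 : Set ℝ) ×ˢ Icc 0 R) :=
    (uniqueDiffOn_Ici 0).prod (uniqueDiffOn_Icc hR)
  have hc := hU.continuousOn_fderivWithin hud le_rfl
  have hc2 : ContinuousOn (fun T : ℝ => fderivWithin ℝ (fun p : ℝ × ℝ => U p.1 p.2)
      (Ici 0 ×ˢ Icc 0 R) (T, Y) (0, 1)) (Ici 0) :=
    (hc.comp (f := fun T : ℝ => (T, Y)) (by fun_prop) (fun T hT => ⟨hT, hY⟩)).clm_apply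
      continuousOn_const
  refine hc2.congr fun T hT => ?_
  have hd := (hU.differentiableOn one_ne_zero (T, Y) ⟨hT, hY⟩).hasFDerivWithinAt
  have hl : HasDerivWithinAt (fun y : ℝ => (T, y)) ((0 : ℝ), (1 : ℝ)) (Icc 0 R) Y :=
    ((hasDerivAt_const Y T).prodMk (hasDerivAt_id Y)).hasDerivWithinAt
  exact (hd.comp_hasDerivWithinAt Y hl (fun y hy => ⟨hT, hy⟩)).derivWithin
    (uniqueDiffOn_Icc hR Y hY)

/-- Lemma 3.4: for `α > 0`, `β > 0`, `n ∈ ℝ`, `κ ≥ 0`, `ε ∈ (0,ε₀]`,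
any solution `U^ε ∈ C³(Q) ∩ C²(Q̄)` of the regularized unsteady problem with
`|U^ε_T| ≤ K₂` on `Q̄` satisfies the flux bound
`(1+κ^α|U^ε_Y|^α)^{(n−1)/α}|U^ε_Y| ≤ K₃(Y+ε)` for `T ≥ 0`, `Y ∈ [0,R]`, where
`K₃ = b₀/2 + 4β²K₂`. -/
theorem stmt11 (α β κ n R b₀ ε₀ ε K₂ : ℝ) (b Ψ : ℝ → ℝ) (U : ℝ → ℝ → ℝ)
    (hα : 0 < α) (hβ : 0 < β) (hκ : 0 ≤ κ)
    (hR : 0 < R) (hε₀ : 0 < ε₀) (hε₀R : ε₀ < R) (hε : ε ∈ Ioc 0 ε₀)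
    (hb : ContDiffOn ℝ 2 b (Icc 0 R))
    (hbb : ∀ Y ∈ Icc 0 R, 0 ≤ b Y ∧ b Y ≤ b₀)
    (hΨ : ContDiffOn ℝ 4 Ψ (Icc 0 R)) (hΨc : PsiCompat R b Ψ)
    (hreg3 : ContDiffOn ℝ 3 (fun p : ℝ × ℝ => U p.1 p.2) (Ioi 0 ×ˢ Ioo 0 R))
    (hreg2 : ContDiffOn ℝ 2 (fun p : ℝ × ℝ => U p.1 p.2) (Ici 0 ×ˢ Icc 0 R))
    (hsol : RegUnsteadySol α κ n β R ε b Ψ U)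
    (hK₂ : K₂ = (1 / (8 * β ^ 2)) *
        (sSup ((fun Y => |Phi α κ n |derivWithin Ψ (Icc 0 R) Y| *
            derivWithin (derivWithin Ψ (Icc 0 R)) (Icc 0 R) Y|) '' Icc 0 R) +
          sSup ((fun Y => (1 + κ ^ α * |derivWithin Ψ (Icc 0 R) Y| ^ α) ^ ((n - 1) / α) *
            |derivWithin Ψ (Icc 0 R) Y / Y|) '' Ioc 0 R) + b₀))
    (hUT : ∀ T ≥ 0, ∀ Y ∈ Icc 0 R, |pT (Ici 0) U T Y| ≤ K₂) :
    ∀ T ≥ 0, ∀ Y ∈ Icc 0 R,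
      (1 + κ ^ α * |pY R U T Y| ^ α) ^ ((n - 1) / α) * |pY R U T Y| ≤
        (b₀ / 2 + 4 * β ^ 2 * K₂) * (Y + ε) := by
  obtain ⟨hpde, hbc, -⟩ := hsol
  have hε0 : 0 < ε := hε.1
  have hK₂0 : 0 ≤ K₂ := (abs_nonneg _).trans (hUT 0 le_rfl 0 ⟨le_rfl, hR.le⟩)
  have hb₀ : 0 ≤ b₀ := (hbb 0 ⟨le_rfl, hR.le⟩).1.trans (hbb 0 ⟨le_rfl, hR.le⟩).2
  have hK : 0 ≤ b₀ / 2 + 4 * β ^ 2 * K₂ := by positivity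
  set g : ℝ → ℝ := fun v => (1 + κ ^ α * |v| ^ α) ^ ((n - 1) / α) * v with hg
  have hgd : ∀ v, HasDerivAt g (Phi α κ n |v|) v := hasDerivAt_flux α κ n hα hκ
  have hgc : Continuous g := continuous_iff_continuousAt.2 fun v => (hgd v).continuousAt
  have habs : ∀ v, (1 + κ ^ α * |v| ^ α) ^ ((n - 1) / α) * |v| = |g v| := by
    intro v
    have : 0 ≤ (1 + κ ^ α * |v| ^ α) ^ ((n - 1) / α) := by positivity
    rw [hg, abs_mul, abs_of_nonneg this]
  simp only [habs]
  have hpos : ∀ T > 0, ∀ Y ∈ Icc 0 R,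
      |g (pY R U T Y)| ≤ (b₀ / 2 + 4 * β ^ 2 * K₂) * (Y + ε) := by
    intro T hT Y hY
    have hUY : ContDiffOn ℝ 2 (U T) (Icc 0 R) :=
      hreg2.comp (f := fun y : ℝ => (T, y)) (by fun_prop) (fun y hy => ⟨hT.le, hy⟩)
    have hv : ContDiffOn ℝ 1 (fun y => pY R U T y) (Icc 0 R) :=
      hUY.derivWithin (uniqueDiffOn_Icc hR) (by norm_num)
    have hF := abs_le_mul_sq_of_abs_deriv_le (R := R) (ε := ε)
      (F := fun y => (y + ε) * g (pY R U T y))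
      (F' := fun y => (y + ε) * (8 * β ^ 2 * pT (Ici 0) U T y - b y)) hK
      (ContinuousOn.mul (by fun_prop) (hgc.comp_continuousOn hv.continuousOn))
      (by simp [(hbc T hT.le).1, hg]) ?_ ?_ Y hY
    · have hYε : 0 < Y + ε := by linarith [hY.1]
      rw [abs_mul, abs_of_pos hYε] at hF
      refine le_of_mul_le_mul_left ?_ hYε
      linarith
    · intro y hy
      have hyI := Ioo_subset_Icc_self hy
      have hyε : 0 < y + ε := by linarith [hy.1]
      have hvd : HasDerivAt (fun y => pY R U T y) (pYY R U T y) y :=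
        ((hv.differentiableOn one_ne_zero y hyI).hasDerivWithinAt).hasDerivAt
          (Icc_mem_nhds hy.1 hy.2)
      refine (((hasDerivAt_id y).add_const ε).mul
        ((hgd (pY R U T y)).comp y hvd)).congr_deriv ?_
      have h := hpde T hT y hy
      simp only [Function.comp, id, hg]
      rw [← h]
      field_simp
      ring
    · intro y hy
      have hyI := Ioo_subset_Icc_self hy
      have hyε : 0 < y + ε := by linarith [hy.1]
      have h1 := abs_le.1 (hUT T hT.le y hyI)
      have h2 := hbb y hyI
      have hβ2 : 0 < 8 * β ^ 2 := by positivity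
      have h3 := mul_le_mul_of_nonneg_left h1.1 hβ2.le
      have h4 := mul_le_mul_of_nonneg_left h1.2 hβ2.le
      have h5 : |8 * β ^ 2 * pT (Ici 0) U T y - b y| ≤ 2 * (b₀ / 2 + 4 * β ^ 2 * K₂) := by
        rw [abs_le]
        constructor <;> linarith
      rw [abs_mul, abs_of_pos hyε, mul_comm]
      exact mul_le_mul_of_nonneg_right h5 hyε.le
  intro T hT Y hY
  rcases hT.lt_or_eq with hT | rfl
  · exact hpos T hT Y hY
  · have hc := continuousOn_pY_time hR (hreg2.of_le one_le_two) hY 0 self_mem_Ici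
    have hlim := (hgc.tendsto _).comp (hc.tendsto.mono_left (nhdsWithin_mono 0 Ioi_subset_Ici_self))
    refine le_of_tendsto hlim.abs ?_
    filter_upwards [self_mem_nhdsWithin] with t ht
    exact hpos t ht Y hY
end
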